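/- arXiv:1910.13250 — 2 statements merged into one kernel-verified Lean document; each statement's English description precedes it below -/
import Mathlib

section
/- Let Γ be a commutative semigroup of nonzero algebraic quaternions generated by finitely many elements of norm greater than 1, and let a, a' be nonzero algebraic quaternions. Then the equation |1 − a f a'| = |a f a'| has only finitely many solutions f ∈ Γ. -/
open Quaternion

/-- A quaternion is algebraic if all four of its coordinates are algebraic over `ℚ`. -/
def AlgQuat (q : ℍ[ℝ]) : Prop :=
  IsAlgebraic ℚ q.re ∧ IsAlgebraic ℚ q.imI ∧ IsAlgebraic ℚ q.imJ ∧ IsAlgebraic ℚ q.imK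

/-- Padé coefficients. -/
def bsC (N m : ℕ) : ℕ := if m ≤ N then Nat.choose (2 * N - m) N * Nat.choose (N + m) N else 0

open Polynomial in
/-- Padé polynomials. -/
noncomputable def bsP (N : ℕ) : ℚ[X] := ∑ m ∈ Finset.range (N + 1), C (bsC N m : ℚ) * X ^ m

open Polynomial in
lemma bsP_coeff (N j : ℕ) : (bsP N).coeff j = bsC N j := by
  simp only [bsP, finsetSum_coeff, coeff_C_mul, coeff_X_pow]
  simp only [mul_ite, mul_one, mul_zero, Finset.sum_ite_eq, Finset.mem_range]
  split_ifs with h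
  · rfl
  · rw [bsC, if_neg (by omega)]; simp

lemma bsC_fact (m k : ℕ) : bsC (m + k) m * ((m + k).factorial ^ 2 * m.factorial * k.factorial)
    = (m + 2 * k).factorial * (2 * m + k).factorial := by
  have h1 := Nat.add_choose_mul_factorial_mul_factorial k (m + k)
  have h2 := Nat.add_choose_mul_factorial_mul_factorial m (m + k)
  rw [bsC, if_pos (by omega)]
  have e1 : 2 * (m + k) - m = k + (m + k) := by omega
  have e2 : m + k + m = m + (m + k) := by omega
  have s1 : (k + (m + k)).choose (m + k) = (k + (m + k)).choose k := by
    rw [Nat.choose_symm_add]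
  have s2 : (m + (m + k)).choose (m + k) = (m + (m + k)).choose m := by
    rw [Nat.choose_symm_add]
  rw [e1, e2]
  have e3 : m + 2 * k = k + (m + k) := by omega
  have e4 : 2 * m + k = m + (m + k) := by omega
  rw [e3, e4, ← h1, ← h2, s1, s2]
  ring

/-- shifted coefficient -/
lemma bsC_shift (n j k t i i' : ℕ) (hjk : j + k = n + 4) (hi : i + i' = t) 
    (N : ℕ) (hN : N + t = n + 4) :
    (if i ≤ j then (bsC N (j - i) : ℚ) else 0) * ((N.factorial : ℚ) ^ 2 * j.factorial * k.factorial)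
    = j.descFactorial i * k.descFactorial i' * (2 * k + j - (2 * i' + i)).factorial *
        (2 * j + k - (2 * i + i')).factorial := by
  by_cases h1 : i ≤ j
  · by_cases h2 : i' ≤ k
    · obtain ⟨m, rfl⟩ := Nat.exists_eq_add_of_le h1
      obtain ⟨l, rfl⟩ := Nat.exists_eq_add_of_le h2
      obtain rfl : N = m + l := by omega
      rw [if_pos h1]
      have := bsC_fact m l
      have a1 := Nat.factorial_mul_descFactorial h1
      have a2 := Nat.factorial_mul_descFactorial h2
      simp only [Nat.add_sub_cancel_left] at a1 a2 ⊢
      have e1 : 2 * (i' + l) + (i + m) - (2 * i' + i) = m + 2 * l := by omega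
      have e2 : 2 * (i + m) + (i' + l) - (2 * i + i') = 2 * m + l := by omega
      rw [e1, e2]
      norm_cast
      rw [← a1, ← a2]
      linear_combination (i + m).descFactorial i * (i' + l).descFactorial i' * this
    · rw [Nat.descFactorial_of_lt (by omega : k < i'), if_pos h1, bsC, if_neg (by omega)]; simp
  · rw [Nat.descFactorial_of_lt (by omega : j < i), if_neg h1]; simp

lemma bsC_rec (n j k : ℕ) (hjk : j + k = n + 4) (hn : 2 ≤ n) :
    (n + 1 : ℚ) * (n + 2) * ((if 0 ≤ j then (bsC (n+2) (j - 0) : ℚ) else 0)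
      - 2 * (if 1 ≤ j then (bsC (n+2) (j - 1) : ℚ) else 0)
      + (if 2 ≤ j then (bsC (n+2) (j - 2) : ℚ) else 0))
    = (2 * n + 3) * (n + 1) * (2 * (if 0 ≤ j then (bsC (n+1) (j - 0) : ℚ) else 0)
      - 3 * (if 1 ≤ j then (bsC (n+1) (j - 1) : ℚ) else 0)
      - 3 * (if 2 ≤ j then (bsC (n+1) (j - 2) : ℚ) else 0)
      + 2 * (if 3 ≤ j then (bsC (n+1) (j - 3) : ℚ) else 0))
      + 3 * (3 * n + 2) * (3 * n + 4) * (if 2 ≤ j then (bsC n (j - 2) : ℚ) else 0) := by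
  have a0 := bsC_shift n j k 2 0 2 hjk (by omega) (n+2) (by omega)
  have a1 := bsC_shift n j k 2 1 1 hjk (by omega) (n+2) (by omega)
  have a2 := bsC_shift n j k 2 2 0 hjk (by omega) (n+2) (by omega)
  have b0 := bsC_shift n j k 3 0 3 hjk (by omega) (n+1) (by omega)
  have b1 := bsC_shift n j k 3 1 2 hjk (by omega) (n+1) (by omega)
  have b2 := bsC_shift n j k 3 2 1 hjk (by omega) (n+1) (by omega)
  have b3 := bsC_shift n j k 3 3 0 hjk (by omega) (n+1) (by omega)
  have c2 := bsC_shift n j k 4 2 2 hjk (by omega) n (by omega)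
  generalize (if 0 ≤ j then (bsC (n+2) (j - 0) : ℚ) else 0) = A0 at *
  generalize (if 1 ≤ j then (bsC (n+2) (j - 1) : ℚ) else 0) = A1 at *
  generalize (if 2 ≤ j then (bsC (n+2) (j - 2) : ℚ) else 0) = A2 at *
  generalize (if 0 ≤ j then (bsC (n+1) (j - 0) : ℚ) else 0) = B0 at *
  generalize (if 1 ≤ j then (bsC (n+1) (j - 1) : ℚ) else 0) = B1 at *
  generalize (if 2 ≤ j then (bsC (n+1) (j - 2) : ℚ) else 0) = B2 at *
  generalize (if 3 ≤ j then (bsC (n+1) (j - 3) : ℚ) else 0) = B3 at *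
  generalize (if 2 ≤ j then (bsC n (j - 2) : ℚ) else 0) = C2 at *
  obtain ⟨a, ha⟩ : ∃ a, 2 * k + j = a + 6 := ⟨2 * k + j - 6, by omega⟩
  obtain ⟨b, hb⟩ : ∃ b, 2 * j + k = b + 6 := ⟨2 * j + k - 6, by omega⟩
  rw [ha, hb] at a0 a1 a2 b0 b1 b2 b3 c2
  have haQ : (a : ℚ) = 2 * k + j - 6 := by
    have : ((2 * k + j : ℕ) : ℚ) = ((a + 6 : ℕ) : ℚ) := by rw [ha]
    push_cast at this; linarith
  have hbQ : (b : ℚ) = 2 * j + k - 6 := by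
    have : ((2 * j + k : ℕ) : ℚ) = ((b + 6 : ℕ) : ℚ) := by rw [hb]
    push_cast at this; linarith
  have hnQ : (n : ℚ) = j + k - 4 := by
    have : ((j + k : ℕ) : ℚ) = ((n + 4 : ℕ) : ℚ) := by rw [hjk]
    push_cast at this; linarith
  have f0 : (n.factorial : ℚ) ≠ 0 := by positivity
  have f1 : (j.factorial : ℚ) ≠ 0 := by positivity
  have f2 : (k.factorial : ℚ) ≠ 0 := by positivity
  have g1 : (n + 1 : ℚ) ≠ 0 := by positivity
  have g2 : (n + 2 : ℚ) ≠ 0 := by positivity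
  have D0 (x : ℕ) : (x.descFactorial 0 : ℚ) = 1 := by simp
  have D1 (x : ℕ) : (x.descFactorial 1 : ℚ) = x := by simp
  have D2 (x : ℕ) : (x.descFactorial 2 : ℚ) = x * (x - 1) := by
    rw [← Nat.cast_descFactorial_two]
  have D3 (x : ℕ) : (x.descFactorial 3 : ℚ) = x * (x - 1) * (x - 2) := by
    rw [Nat.descFactorial_succ, Nat.cast_mul, D2]
    rcases lt_or_ge x 2 with h | h
    · interval_cases x <;> simp
    · rw [Nat.cast_sub h]; push_cast; ring
  have S (x : ℕ) : x + 6 - 2 = x + 1 + 1 + 1 + 1 ∧ x + 6 - 3 = x + 1 + 1 + 1 ∧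
      x + 6 - 4 = x + 1 + 1 ∧ x + 6 - 5 = x + 1 ∧ x + 6 - 6 = x := by omega
  have S2 := fun x => (S x).1
  have S3 := fun x => (S x).2.1
  have S4 := fun x => (S x).2.2.1
  have S5 := fun x => (S x).2.2.2.1
  have S6 := fun x => (S x).2.2.2.2
  simp only [D0, D1, D2, D3, Nat.reduceMul, Nat.reduceAdd, S2, S3, S4, S5, S6,
    Nat.factorial_succ, Nat.cast_mul, 
    Nat.cast_succ] at a0 a1 a2 b0 b1 b2 b3 c2
  have hden : ((n.factorial : ℚ) ^ 2 * j.factorial * k.factorial * (n+1)^2 * (n+2)^2) ≠ 0 := by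
    positivity
  apply mul_right_cancel₀ hden
  clear hden f0 f1 f2 g1 g2 D0 D1 D2 D3 S S2 S3 S4 S5 S6
  generalize (n.factorial : ℚ) = nf at *
  generalize (j.factorial : ℚ) = jf at *
  generalize (k.factorial : ℚ) = kf at *
  generalize (a.factorial : ℚ) = af at *
  generalize (b.factorial : ℚ) = bf at *
  generalize (n : ℚ) = n' at *
  generalize (a : ℚ) = a' at *
  generalize (b : ℚ) = b' at *
  subst hnQ haQ hbQ
  generalize (j : ℚ) = x at *
  generalize (k : ℚ) = y at *
  linear_combination (x + y - 3) * (x + y - 2) * (a0 - 2 * a1 + a2)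
    - (2 * x + 2 * y - 5) * (x + y - 3) * (x + y - 2) ^ 2 * (2 * b0 - 3 * b1 - 3 * b2 + 2 * b3)
    - 3 * (3 * x + 3 * y - 10) * (3 * x + 3 * y - 8) * (x + y - 3) ^ 2 * (x + y - 2) ^ 2 * c2


open Polynomial in
lemma bsP_rec (n : ℕ) :
    C ((n + 1 : ℚ) * (n + 2)) * ((1 - X) ^ 2 * bsP (n + 2))
    = C ((2 * n + 3 : ℚ) * (n + 1)) * ((1 + X) * (1 - 2 * X) * (2 - X) * bsP (n + 1))
      + C (3 * (3 * n + 2 : ℚ) * (3 * n + 4)) * (X ^ 2 * bsP n) := by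
  rcases lt_or_ge n 2 with hn | hn
  · have h0 (r : ℚ) : (bsP 0).eval r = 1 := by
      simp [bsP, bsC]
    have h1 (r : ℚ) : (bsP 1).eval r = 2 + 2 * r := by
      simp [bsP, bsC, Finset.sum_range_succ, Nat.choose]; try norm_num
      try ring
    have h2 (r : ℚ) : (bsP 2).eval r = 6 + 9 * r + 6 * r ^ 2 := by
      simp [bsP, bsC, Finset.sum_range_succ, Nat.choose]; try norm_num
      try ring
    have h3 (r : ℚ) : (bsP 3).eval r = 20 + 40 * r + 40 * r ^ 2 + 20 * r ^ 3 := by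
      simp [bsP, bsC, Finset.sum_range_succ, Nat.choose]; try norm_num
      try ring
    apply Polynomial.funext
    intro r
    interval_cases n
    · simp only [eval_mul, eval_add, eval_sub, eval_pow, eval_C, eval_X, eval_one, eval_ofNat,
        h0, h1, h2, zero_add]
      push_cast
      ring
    · simp only [eval_mul, eval_add, eval_sub, eval_pow, eval_C, eval_X, eval_one, eval_ofNat,
        Nat.reduceAdd, h3, h1, h2]
      push_cast
      ring
  · ext j
    have e1 : (1 - X) ^ 2 * bsP (n + 2) = X ^ 0 * bsP (n+2) - C 2 * (X ^ 1 * bsP (n+2))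
      + X ^ 2 * bsP (n+2) := by
      have h2 : (C 2 : ℚ[X]) = 2 := rfl
      rw [h2]; ring
    have e2 : (1 + X) * (1 - 2 * X) * (2 - X) * bsP (n + 1) = C 2 * (X ^ 0 * bsP (n+1))
      - C 3 * (X ^ 1 * bsP (n+1)) - C 3 * (X ^ 2 * bsP (n+1)) + C 2 * (X ^ 3 * bsP (n+1)) := by
      have h2 : (C 2 : ℚ[X]) = 2 := rfl
      have h3 : (C 3 : ℚ[X]) = 3 := rfl
      rw [h2, h3]; ring
    rw [e1, e2]
    simp only [coeff_C_mul, coeff_add, coeff_sub, coeff_X_pow_mul', bsP_coeff]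
    rcases le_or_gt j (n + 4) with h | h
    · exact bsC_rec n j (n + 4 - j) (by omega) hn
    · have z (N i : ℕ) (hi : i + N ≤ n + 4) : (if i ≤ j then (bsC N (j - i) : ℚ) else 0) = 0 := by
        rw [if_pos (by omega), bsC, if_neg (by omega)]; simp
      rw [z _ _ (by omega), z _ _ (by omega), z _ _ (by omega), z _ _ (by omega), z _ _ (by omega),
        z _ _ (by omega), z _ _ (by omega), z _ _ (by omega)]
      simp

/-- homogeneous Padé polynomials -/
def bsW {K : Type*} [Field K] (N : ℕ) (a b : K) : K :=
  ∑ m ∈ Finset.range (N + 1), (bsC N m : K) * a ^ (N - m) * (-b) ^ m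

lemma bsW_eq {K : Type*} [Field K] [CharZero K] (N : ℕ) (a b : K) (ha : a ≠ 0) :
    bsW N a b = a ^ N * Polynomial.aeval (-b / a) (bsP N) := by
  simp only [bsW, bsP, map_sum, map_mul, map_pow, Polynomial.aeval_X, Polynomial.aeval_C,
    map_natCast, Finset.mul_sum]
  refine Finset.sum_congr rfl fun m hm => ?_
  have : N = (N - m) + m := by have := Finset.mem_range.1 hm; omega
  nth_rewrite 3 [this]
  rw [pow_add, div_pow]
  field_simp

lemma bsW_rec {K : Type*} [Field K] [CharZero K] (n : ℕ) (x y z : K) (hx : x ≠ 0)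
    (h : x + y + z = 0) :
    (n + 1 : K) * (n + 2) * (z ^ 2 * bsW (n + 2) x y)
    = - ((2 * n + 3 : K) * (n + 1)) * ((x - y) * (y - z) * (z - x) * bsW (n + 1) x y)
      + 3 * (3 * n + 2 : K) * (3 * n + 4) * (x ^ 2 * y ^ 2 * bsW n x y) := by
  have key := congrArg (Polynomial.aeval (-y / x)) (bsP_rec n)
  simp only [map_mul, map_add, map_sub, map_pow, map_one, Polynomial.aeval_X, Polynomial.aeval_C,
    map_ofNat, map_natCast] at key
  rw [bsW_eq _ _ _ hx, bsW_eq _ _ _ hx, bsW_eq _ _ _ hx]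
  obtain rfl : z = -x - y := by linear_combination h
  generalize Polynomial.aeval (-y / x) (bsP n) = p0 at *
  generalize Polynomial.aeval (-y / x) (bsP (n+1)) = p1 at *
  generalize Polynomial.aeval (-y / x) (bsP (n+2)) = p2 at *
  obtain ⟨t, rfl⟩ : ∃ t, y = -(t * x) := ⟨-y / x, by field_simp⟩
  have : -(-(t * x)) / x = t := by field_simp
  rw [this] at key
  linear_combination x ^ (n + 4) * key

/-- the sequences `x_i ^ (2N+1) W_N` all satisfy the same recurrence -/
lemma bsU_rec {K : Type*} [Field K] [CharZero K] (n : ℕ) (x y z : K) (hx : x ≠ 0)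
    (h : x + y + z = 0) :
    (n + 1 : K) * (n + 2) * (z ^ (2 * (n + 2) + 1) * bsW (n + 2) x y)
    = - ((2 * n + 3 : K) * (n + 1)) * ((x - y) * (y - z) * (z - x)) *
        (z ^ (2 * (n + 1) + 1) * bsW (n + 1) x y)
      + 3 * (3 * n + 2 : K) * (3 * n + 4) * ((x * y * z) ^ 2) * (z ^ (2 * n + 1) * bsW n x y) := by
  linear_combination z ^ (2 * n + 3) * bsW_rec n x y z hx h

lemma bsW_zero {K : Type*} [Field K] (a b : K) : bsW 0 a b = 1 := by simp [bsW, bsC]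

lemma bsW_one {K : Type*} [Field K] (a b : K) : bsW 1 a b = 2 * (a - b) := by
  simp [bsW, bsC, Finset.sum_range_succ]; ring

lemma bsU_sum {K : Type*} [Field K] [CharZero K] (x y z : K) (hx : x ≠ 0) (hy : y ≠ 0)
    (hz : z ≠ 0) (h : x + y + z = 0) (n : ℕ) :
    x ^ (2 * n + 1) * bsW n y z + y ^ (2 * n + 1) * bsW n z x + z ^ (2 * n + 1) * bsW n x y = 0 := by
  induction n using Nat.twoStepInduction with
  | zero => simpa [bsW_zero] using h
  | one =>
    obtain rfl : z = -x - y := by linear_combination h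
    simp only [bsW_one]; ring
  | more n h0 h1 =>
    have a := bsU_rec n y z x hy (by linear_combination h)
    have b := bsU_rec n z x y hz (by linear_combination h)
    have c := bsU_rec n x y z hx h
    have : (n + 1 : K) * (n + 2) ≠ 0 := by
      have : ((n + 1 : ℕ) : K) * ((n + 2 : ℕ) : K) ≠ 0 := by
        exact mul_ne_zero (Nat.cast_ne_zero.2 (by omega)) (Nat.cast_ne_zero.2 (by omega))
      push_cast at this; exact this
    apply mul_left_cancel₀ this
    rw [mul_zero]
    linear_combination a + b + c - ((2 * n + 3 : K) * (n + 1)) * ((x - y) * (y - z) * (z - x)) * h1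
      + 3 * (3 * n + 2 : K) * (3 * n + 4) * ((x * y * z) ^ 2) * h0

lemma bsU_det {K : Type*} [Field K] [CharZero K] (x y z : K) (hx : x ≠ 0) (hy : y ≠ 0)
    (hz : z ≠ 0) (h : x + y + z = 0) (hq : x ^ 2 + x * y + y ^ 2 ≠ 0) (n : ℕ) :
    (y ^ (2 * n + 1) * bsW n z x) * (z ^ (2 * (n + 1) + 1) * bsW (n + 1) x y) -
    (z ^ (2 * n + 1) * bsW n x y) * (y ^ (2 * (n + 1) + 1) * bsW (n + 1) z x) ≠ 0 := by
  induction n with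
  | zero =>
    simp only [bsW_zero, zero_add, bsW_one]
    have : x * y * z * (x ^ 2 + x * y + y ^ 2) * 2 ≠ 0 := by
      refine mul_ne_zero (mul_ne_zero (mul_ne_zero (mul_ne_zero hx hy) hz) hq) two_ne_zero
    convert this using 1
    obtain rfl : z = -x - y := by linear_combination h
    ring
  | succ n ih =>
    have b := bsU_rec n z x y hz (by linear_combination h)
    have c := bsU_rec n x y z hx h
    intro hc
    apply ih
    have : 3 * (3 * n + 2 : K) * (3 * n + 4) * ((x * y * z) ^ 2) ≠ 0 := by
      have : ((3 * (3 * n + 2) * (3 * n + 4) : ℕ) : K) ≠ 0 := by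
        exact Nat.cast_ne_zero.2 (by positivity)
      push_cast at this
      exact mul_ne_zero this (pow_ne_zero _ (mul_ne_zero (mul_ne_zero hx hy) hz))
    apply mul_left_cancel₀ this
    rw [mul_zero]
    have hc' : (y ^ (2 * (n + 1) + 1) * bsW (n + 1) z x) * (z ^ (2 * (n + 2) + 1) * bsW (n + 2) x y) -
      (z ^ (2 * (n + 1) + 1) * bsW (n + 1) x y) * (y ^ (2 * (n + 2) + 1) * bsW (n + 2) z x) = 0 := hc
    generalize y ^ (2 * (n + 1) + 1) * bsW (n + 1) z x = b1 at *
    generalize z ^ (2 * (n + 1) + 1) * bsW (n + 1) x y = c1 at *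
    generalize y ^ (2 * (n + 2) + 1) * bsW (n + 2) z x = b2 at *
    generalize z ^ (2 * (n + 2) + 1) * bsW (n + 2) x y = c2 at *
    generalize y ^ (2 * n + 1) * bsW n z x = b0 at *
    generalize z ^ (2 * n + 1) * bsW n x y = c0 at *
    linear_combination b1 * c - c1 * b - (n + 1 : K) * (n + 2) * hc'

open Height AdmissibleAbsValues in
lemma bs_height_le {K : Type*} [Field K] [AdmissibleAbsValues K] (w t x : Fin 3 → K)
    (hw : ∀ i, w i ≠ 0) (ht : ∀ i, t i ≠ 0) (hx : ∀ i, x i ≠ 0) (N : ℕ) (c : ℝ)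
    (h1 : ∀ v : AbsoluteValue K ℝ, ∀ i, v (w i) ≤ c * (⨆ j, v (t j)) * (⨆ j, v (x j)) ^ N)
    (h2 : ∀ v : AbsoluteValue K ℝ, IsNonarchimedean v →
      ∀ i, v (w i) ≤ (⨆ j, v (t j)) * (⨆ j, v (x j)) ^ N) :
    mulHeight w ≤ c ^ totalWeight K * mulHeight t * mulHeight x ^ N := by
  have fs (y : Fin 3 → K) (hy : ∀ i, y i ≠ 0) :
      (fun v : nonarchAbsVal (K := K) ↦ ⨆ i, v.val (y i)).HasFiniteMulSupport :=
    Function.HasFiniteMulSupport.iSup fun i => hasFiniteMulSupport (hy i)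
  have nz (y : Fin 3 → K) (hy : ∀ i, y i ≠ 0) : y ≠ 0 := fun h => hy 0 (by simp [h])
  rw [mulHeight_eq (nz w hw), mulHeight_eq (nz t ht), mulHeight_eq (nz x hx)]
  have e : ∀ a b b' d d' : ℝ, a * (b * b') * (d * d') ^ N = (a * b * d ^ N) * (b' * d' ^ N) := by
    intros; ring
  rw [e]
  have nn (v : AbsoluteValue K ℝ) (y : Fin 3 → K) : 0 ≤ ⨆ i, v (y i) :=
    Real.iSup_nonneg fun i => v.nonneg _
  have A : (archAbsVal.map fun v : AbsoluteValue K ℝ ↦ ⨆ i, v (w i)).prod ≤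
      c ^ totalWeight K * (archAbsVal.map fun v : AbsoluteValue K ℝ ↦ ⨆ i, v (t i)).prod *
      (archAbsVal.map fun v : AbsoluteValue K ℝ ↦ ⨆ i, v (x i)).prod ^ N := by
    rw [← Multiset.prod_map_pow, ← Multiset.prod_replicate, totalWeight, ← Multiset.map_const',
      ← Multiset.prod_map_mul, ← Multiset.prod_map_mul]
    refine Multiset.prod_map_le_prod_map₀ _ _ (fun v _ ↦ nn v w) fun v _ ↦ ?_
    exact ciSup_le (h1 v)
  have B : (∏ᶠ v : nonarchAbsVal (K := K), ⨆ i, v.val (w i)) ≤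
      (∏ᶠ v : nonarchAbsVal (K := K), ⨆ i, v.val (t i)) *
      (∏ᶠ v : nonarchAbsVal (K := K), ⨆ i, v.val (x i)) ^ N := by
    have fp : (fun v : nonarchAbsVal (K := K) ↦ (⨆ i, v.val (x i)) ^ N).HasFiniteMulSupport :=
      (fs x hx).pow N
    rw [finprod_pow (fs x hx), ← finprod_mul_distrib (fs t ht) fp]
    refine finprod_le_finprod (fs w hw) (fun v => nn v.val w) ((fs t ht).mul fp) ?_
    intro v
    exact ciSup_le (h2 v.val (isNonarchimedean _ v.prop))
  refine mul_le_mul A B (finprod_nonneg fun v => nn v.val w) ?_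
  exact le_trans (Multiset.prod_map_nonneg fun v _ => nn v w) A

lemma bsC_le (N m : ℕ) : bsC N m ≤ 8 ^ N := by
  unfold bsC
  split_ifs with h
  · calc _ ≤ 2 ^ (2 * N - m) * 2 ^ (N + m) :=
        Nat.mul_le_mul (Nat.choose_le_two_pow _ _) (Nat.choose_le_two_pow _ _)
      _ = 8 ^ N := by
        rw [← pow_add, show 2 * N - m + (N + m) = 3 * N by omega, pow_mul]; norm_num
  · exact Nat.zero_le _

lemma abv_natCast_le {K : Type*} [Field K] (v : AbsoluteValue K ℝ) (n : ℕ) : v (n : K) ≤ n := by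
  induction n with
  | zero => simp
  | succ n ih =>
    push_cast
    calc _ ≤ v (n : K) + v 1 := v.add_le _ _
      _ ≤ _ := by rw [map_one]; linarith

lemma bsW_arch {K : Type*} [Field K] (v : AbsoluteValue K ℝ) (N : ℕ) (a b : K) (B : ℝ)
    (ha : v a ≤ B) (hb : v b ≤ B) : v (bsW N a b) ≤ 16 ^ N * B ^ N := by
  have hB : 0 ≤ B := (v.nonneg a).trans ha
  unfold bsW
  refine (v.sum_le _ _).trans ?_
  have : ∀ m ∈ Finset.range (N + 1), v ((bsC N m : K) * a ^ (N - m) * (-b) ^ m) ≤ 8 ^ N * B ^ N := by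
    intro m hm
    have hm' : N = (N - m) + m := by have := Finset.mem_range.1 hm; omega
    rw [map_mul, map_mul, map_pow, map_pow, v.map_neg]
    calc _ ≤ (8 : ℝ) ^ N * B ^ (N - m) * B ^ m := by
          gcongr
          · exact (abv_natCast_le v _).trans (by exact_mod_cast bsC_le N m)
      _ = _ := by rw [mul_assoc, ← pow_add, ← hm']
  refine (Finset.sum_le_sum this).trans ?_
  rw [Finset.sum_const, Finset.card_range, nsmul_eq_mul, ← mul_assoc]
  gcongr
  calc ((N + 1 : ℕ) : ℝ) * 8 ^ N ≤ 2 ^ N * 8 ^ N := by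
        gcongr
        exact_mod_cast Nat.lt_two_pow_self
    _ = 16 ^ N := by rw [← mul_pow]; norm_num

lemma bsW_nonarch {K : Type*} [Field K] (v : AbsoluteValue K ℝ) (hv : IsNonarchimedean v)
    (N : ℕ) (a b : K) (B : ℝ)
    (ha : v a ≤ B) (hb : v b ≤ B) : v (bsW N a b) ≤ B ^ N := by
  have hB : 0 ≤ B := (v.nonneg a).trans ha
  unfold bsW
  refine (hv.apply_sum_le).trans ?_
  have : Nonempty (Finset.range (N + 1)) := ⟨⟨0, by simp⟩⟩
  refine ciSup_le fun ⟨m, hm⟩ => ?_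
  have hm' : N = (N - m) + m := by have := Finset.mem_range.1 hm; omega
  rw [map_mul, map_mul, map_pow, map_pow, v.map_neg]
  calc _ ≤ (1 : ℝ) * B ^ (N - m) * B ^ m := by
          gcongr
          · exact hv.apply_natCast_le_one
      _ = _ := by rw [mul_assoc, ← pow_add, ← hm', one_mul]

open Height AdmissibleAbsValues in
lemma bs_key_one {K : Type*} [Field K] [CharZero K] [AdmissibleAbsValues K] (x t : Fin 3 → K)
    (hx : ∀ i, x i ≠ 0) (ht : ∀ i, t i ≠ 0) (h : x 0 + x 1 + x 2 = 0) (N : ℕ)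
    (hT : t 0 * x 0 ^ (2 * N + 1) + t 1 * x 1 ^ (2 * N + 1) + t 2 * x 2 ^ (2 * N + 1) = 0)
    (hc : t 1 * bsW N (x 0) (x 1) - t 2 * bsW N (x 2) (x 0) ≠ 0) :
    mulHeight x ^ (N + 1) ≤ (2 * 16 ^ N) ^ totalWeight K * mulHeight t := by
  have hF := bsU_sum (x 0) (x 1) (x 2) (hx 0) (hx 1) (hx 2) h N
  set A := bsW N (x 1) (x 2) with hA
  set B := bsW N (x 2) (x 0) with hB
  set C := bsW N (x 0) (x 1) with hC
  have hp (i) : x i ^ (2 * N + 1) ≠ 0 := pow_ne_zero _ (hx i)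
  set l := (t 1 * C - t 2 * B) / x 0 ^ (2 * N + 1) with hl
  have hl0 : l ≠ 0 := div_ne_zero hc (hp 0)
  have e0 : (t 1 * C - t 2 * B) = l * x 0 ^ (2 * N + 1) := by rw [hl]; field_simp [hp 0]
  have e1 : (t 2 * A - t 0 * C) = l * x 1 ^ (2 * N + 1) := by
    apply mul_left_cancel₀ (hp 0)
    linear_combination x 1 ^ (2 * N + 1) * e0 + t 2 * hF - C * hT
  have e2 : (t 0 * B - t 1 * A) = l * x 2 ^ (2 * N + 1) := by
    apply mul_left_cancel₀ (hp 0)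
    linear_combination x 2 ^ (2 * N + 1) * e0 - t 1 * hF + B * hT
  have main := bs_height_le (l • x ^ (2 * N + 1)) t x
    (fun i => mul_ne_zero hl0 (hp i)) ht hx N (2 * 16 ^ N) ?_ ?_
  · rw [mulHeight_smul_eq_mulHeight _ hl0, mulHeight_pow] at main
    have hpos := mulHeight_pos x
    have : mulHeight x ^ (N + 1) * mulHeight x ^ N ≤
        ((2 * 16 ^ N) ^ totalWeight K * mulHeight t) * mulHeight x ^ N := by
      rw [← pow_add, show N + 1 + N = 2 * N + 1 by ring]; exact main
    exact le_of_mul_le_mul_right this (pow_pos hpos N)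
  · intro v
    have bx (i) : v (x i) ≤ ⨆ j, v (x j) := Finite.le_ciSup (fun j => v (x j)) i
    have bt (i) : v (t i) ≤ ⨆ j, v (t j) := Finite.le_ciSup (fun j => v (t j)) i
    have bA := bsW_arch v N _ _ _ (bx 1) (bx 2)
    have bB := bsW_arch v N _ _ _ (bx 2) (bx 0)
    have bC := bsW_arch v N _ _ _ (bx 0) (bx 1)
    have aux (p q r s : K) (hp : v p ≤ ⨆ j, v (t j)) (hr : v r ≤ ⨆ j, v (t j))
        (hq : v q ≤ 16 ^ N * (⨆ j, v (x j)) ^ N) (hs : v s ≤ 16 ^ N * (⨆ j, v (x j)) ^ N) :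
        v (p * q - r * s) ≤ 2 * 16 ^ N * (⨆ j, v (t j)) * (⨆ j, v (x j)) ^ N := by
      have h1 : v (p * q - r * s) ≤ v p * v q + v r * v s := by
        rw [← map_mul, ← map_mul]; exact v.sub_le_add _ _
      have h2 := mul_le_mul hp hq (v.nonneg _) ((v.nonneg _).trans hp)
      have h3 := mul_le_mul hr hs (v.nonneg _) ((v.nonneg _).trans hr)
      linarith
    intro i
    fin_cases i
    · simp only [Fin.zero_eta, Pi.smul_apply, Pi.pow_apply, smul_eq_mul, ← e0]
      exact aux _ _ _ _ (bt 1) (bt 2) bC bB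
    · simp only [Fin.mk_one, Pi.smul_apply, Pi.pow_apply, smul_eq_mul, ← e1]
      exact aux _ _ _ _ (bt 2) (bt 0) bA bC
    · simp only [Fin.reduceFinMk, Pi.smul_apply, Pi.pow_apply, smul_eq_mul, ← e2]
      exact aux _ _ _ _ (bt 0) (bt 1) bB bA
  · intro v hv
    have bx (i) : v (x i) ≤ ⨆ j, v (x j) := Finite.le_ciSup (fun j => v (x j)) i
    have bt (i) : v (t i) ≤ ⨆ j, v (t j) := Finite.le_ciSup (fun j => v (t j)) i
    have bA := bsW_nonarch v hv N _ _ _ (bx 1) (bx 2)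
    have bB := bsW_nonarch v hv N _ _ _ (bx 2) (bx 0)
    have bC := bsW_nonarch v hv N _ _ _ (bx 0) (bx 1)
    have aux (p q r s : K) (hp : v p ≤ ⨆ j, v (t j)) (hr : v r ≤ ⨆ j, v (t j))
        (hq : v q ≤ (⨆ j, v (x j)) ^ N) (hs : v s ≤ (⨆ j, v (x j)) ^ N) :
        v (p * q - r * s) ≤ (⨆ j, v (t j)) * (⨆ j, v (x j)) ^ N := by
      have h1 : v (p * q - r * s) ≤ max (v p * v q) (v r * v s) := by
        rw [← map_mul, ← map_mul, sub_eq_add_neg, ← v.map_neg (r * s)]; exact hv _ _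
      have h2 := mul_le_mul hp hq (v.nonneg _) ((v.nonneg _).trans hp)
      have h3 := mul_le_mul hr hs (v.nonneg _) ((v.nonneg _).trans hr)
      exact h1.trans (max_le h2 h3)
    intro i
    fin_cases i
    · simp only [Fin.zero_eta, Pi.smul_apply, Pi.pow_apply, smul_eq_mul, ← e0]
      exact aux _ _ _ _ (bt 1) (bt 2) bC bB
    · simp only [Fin.mk_one, Pi.smul_apply, Pi.pow_apply, smul_eq_mul, ← e1]
      exact aux _ _ _ _ (bt 2) (bt 0) bA bC
    · simp only [Fin.reduceFinMk, Pi.smul_apply, Pi.pow_apply, smul_eq_mul, ← e2]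
      exact aux _ _ _ _ (bt 0) (bt 1) bB bA

open Height AdmissibleAbsValues in
lemma bs_key {K : Type*} [Field K] [CharZero K] [AdmissibleAbsValues K] (x x' : Fin 3 → K)
    (hx : ∀ i, x i ≠ 0) (hx' : ∀ i, x' i ≠ 0) (h : x 0 + x 1 + x 2 = 0)
    (h' : x' 0 + x' 1 + x' 2 = 0) (hq : x 0 ^ 2 + x 0 * x 1 + x 1 ^ 2 ≠ 0) (N : ℕ) :
    ∃ M, (M = N ∨ M = N + 1) ∧ mulHeight x ^ (M + 1) ≤ (2 * 16 ^ M) ^ totalWeight K *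
      mulHeight (x' / x ^ (2 * M + 1)) := by
  have hT (M : ℕ) : (x' / x ^ (2 * M + 1)) 0 * x 0 ^ (2 * M + 1) +
     (x' / x ^ (2 * M + 1)) 1 * x 1 ^ (2 * M + 1) + (x' / x ^ (2 * M + 1)) 2 * x 2 ^ (2 * M + 1) = 0 := by
    simp only [Pi.div_apply, Pi.pow_apply]
    rw [div_mul_cancel₀ _ (pow_ne_zero _ (hx 0)), div_mul_cancel₀ _ (pow_ne_zero _ (hx 1)),
      div_mul_cancel₀ _ (pow_ne_zero _ (hx 2)), h']
  have ht (M : ℕ) (i) : (x' / x ^ (2 * M + 1)) i ≠ 0 := div_ne_zero (hx' i) (pow_ne_zero _ (hx i))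
  have hz (M : ℕ) (h0 : (x' / x ^ (2 * M + 1)) 1 * bsW M (x 0) (x 1) -
      (x' / x ^ (2 * M + 1)) 2 * bsW M (x 2) (x 0) = 0) :
      x' 1 * (x 2 ^ (2 * M + 1) * bsW M (x 0) (x 1)) =
        x' 2 * (x 1 ^ (2 * M + 1) * bsW M (x 2) (x 0)) := by
    simp only [Pi.div_apply, Pi.pow_apply] at h0
    have := hx 1
    have := hx 2
    field_simp at h0
    linear_combination h0
  by_cases c0 : (x' / x ^ (2 * N + 1)) 1 * bsW N (x 0) (x 1) -
      (x' / x ^ (2 * N + 1)) 2 * bsW N (x 2) (x 0) = 0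
  · by_cases c1 : (x' / x ^ (2 * (N + 1) + 1)) 1 * bsW (N + 1) (x 0) (x 1) -
      (x' / x ^ (2 * (N + 1) + 1)) 2 * bsW (N + 1) (x 2) (x 0) = 0
    · exfalso
      apply bsU_det (x 0) (x 1) (x 2) (hx 0) (hx 1) (hx 2) h hq N
      have d0 := hz _ c0
      have d1 := hz _ c1
      generalize x 2 ^ (2 * N + 1) * bsW N (x 0) (x 1) = p at *
      generalize x 1 ^ (2 * N + 1) * bsW N (x 2) (x 0) = q at *
      generalize x 2 ^ (2 * (N + 1) + 1) * bsW (N + 1) (x 0) (x 1) = r at *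
      generalize x 1 ^ (2 * (N + 1) + 1) * bsW (N + 1) (x 2) (x 0) = s at *
      apply mul_left_cancel₀ (hx' 1)
      linear_combination q * d1 - s * d0
    · exact ⟨N + 1, .inr rfl, bs_key_one x _ hx (ht _) h _ (hT _) c1⟩
  · exact ⟨N, .inl rfl, bs_key_one x _ hx (ht _) h _ (hT _) c0⟩


lemma bs_comb {ι : Type*} [Fintype ι] (E : Set (ι → ℕ)) (hE : E.Infinite) (lam e c : ℝ)
    (hl : 0 < lam) (he : 0 ≤ e) (R : ℝ) :
    ∃ u ∈ E, ∃ u' ∈ E, ∃ N : ℕ, R ≤ ((∑ i, u i : ℕ) : ℝ) ∧ ∀ M : ℕ, (M = N ∨ M = N + 1) →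
      e * ∑ i, |(u' i : ℝ) - (2 * M + 1) * u i| < (M + 1) * (lam * ((∑ i, u i : ℕ) : ℝ) - c) := by
  classical
  set d : ℝ := ((Fintype.card ι : ℕ) : ℝ) with hd
  have hd0 : 0 ≤ d := by positivity
  obtain ⟨Q, hQ⟩ := exists_nat_gt (8 * e * d / lam)
  have hQ0 : (0 : ℝ) < Q := lt_of_le_of_lt (by positivity) hQ
  have big (E' : Set (ι → ℕ)) (h : E'.Infinite) (B : ℝ) : ∃ u ∈ E', B ≤ ((∑ i, u i : ℕ) : ℝ) := by
    by_contra hcon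
    push Not at hcon
    apply h
    refine (Set.finite_Icc (0 : ι → ℕ) (fun _ => ⌈B⌉₊)).subset fun u hu => ?_
    refine ⟨fun i => Nat.zero_le _, fun i => ?_⟩
    have h1 := hcon u hu
    have h2 : u i ≤ ∑ i, u i := Finset.single_le_sum (fun _ _ => Nat.zero_le _) (Finset.mem_univ i)
    have h3 : ((∑ i, u i : ℕ) : ℝ) ≤ ⌈B⌉₊ := h1.le.trans (Nat.le_ceil B)
    exact h2.trans (by exact_mod_cast h3)
  let f : E → (ι → Fin (Q + 1)) := fun u i =>
    ⟨min ⌊(Q : ℝ) * (u.1 i / ((∑ i, u.1 i : ℕ) : ℝ))⌋₊ Q, by omega⟩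
  have : Infinite E := hE.to_subtype
  obtain ⟨y, hy⟩ := Finite.exists_infinite_fiber f
  set E' : Set (ι → ℕ) := Subtype.val '' (f ⁻¹' {y}) with hE'
  have hE'inf : E'.Infinite := (Set.infinite_coe_iff.1 hy).image Subtype.val_injective.injOn
  obtain ⟨u, hu, hu1⟩ := big E' hE'inf (max (max R 1) (4 * |c| / lam))
  set U : ℝ := ((∑ i, u i : ℕ) : ℝ) with hU
  have hU1 : 1 ≤ U := (le_max_right _ _).trans ((le_max_left _ _).trans hu1)
  have hU2 : 4 * |c| / lam ≤ U := (le_max_right _ _).trans hu1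
  obtain ⟨u', hu', hu2⟩ := big E' hE'inf (2 * U * (6 * e / lam + 1))
  set U' : ℝ := ((∑ i, u' i : ℕ) : ℝ) with hU'
  have hpos : 0 < 6 * e / lam + 1 := by positivity
  have hU'1 : 0 < U' := lt_of_lt_of_le (by positivity) hu2
  set N := ⌊U' / (2 * U)⌋₊ with hN
  have hN1 : (N : ℝ) ≤ U' / (2 * U) := Nat.floor_le (by positivity)
  have hN2 : U' / (2 * U) < N + 1 := Nat.lt_floor_add_one _
  rw [le_div_iff₀ (by positivity)] at hN1
  have hN3 : 6 * e / lam + 1 < N + 1 := by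
    refine lt_of_le_of_lt ?_ hN2
    rw [le_div_iff₀ (by positivity)]; linarith
  rw [div_lt_iff₀ (by positivity)] at hN2
  have memE {w} (hw : w ∈ E') : w ∈ E := by
    obtain ⟨a, _, rfl⟩ := hw; exact a.2
  have close (i : ι) : |(u' i : ℝ) / U' - u i / U| ≤ 1 / Q := by
    have fl {w} (hw : w ∈ E') (hw0 : 0 < ((∑ i, w i : ℕ) : ℝ)) :
        ((y i : ℕ) : ℝ) ≤ Q * (w i / ((∑ i, w i : ℕ) : ℝ)) ∧
          Q * (w i / ((∑ i, w i : ℕ) : ℝ)) < (y i : ℕ) + 1 := by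
      obtain ⟨a, ha, rfl⟩ := hw
      have hfa : f a = y := ha
      have e1 : (y i : ℕ) = ⌊(Q : ℝ) * (a.1 i / ((∑ i, a.1 i : ℕ) : ℝ))⌋₊ := by
        rw [← hfa]
        show min _ _ = _
        apply min_eq_left
        apply Nat.floor_le_of_le
        have : (a.1 i : ℝ) / ((∑ i, a.1 i : ℕ) : ℝ) ≤ 1 := by
          rw [div_le_one hw0]
          exact_mod_cast Finset.single_le_sum (f := a.1) (fun _ _ => Nat.zero_le _) (Finset.mem_univ i)
        nlinarith
      rw [e1]
      exact ⟨Nat.floor_le (by positivity), Nat.lt_floor_add_one _⟩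
    have a1 := fl hu (by positivity)
    have a2 := fl hu' hU'1
    rw [← hU] at a1
    rw [← hU'] at a2
    rw [le_div_iff₀ hQ0, ← abs_of_pos hQ0, ← abs_mul, abs_le]
    constructor <;> nlinarith
  refine ⟨u, memE hu, u', memE hu', N, (le_max_left _ _).trans ((le_max_left _ _).trans hu1), ?_⟩
  intro M hM
  have hM1 : |U' - (2 * M + 1) * U| ≤ 3 * U := by
    rw [abs_le]
    rcases hM with rfl | rfl
    · constructor <;> nlinarith
    · push_cast
      constructor <;> nlinarith
  have hMN : (N : ℝ) ≤ M := by
    rcases hM with rfl | rfl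
    · rfl
    · push_cast; linarith
  have sumU : ∑ i, (u i : ℝ) / U = 1 := by
    rw [← Finset.sum_div, hU]; push_cast
    rw [div_self]; push_cast at hU; rw [← hU]; positivity
  have S : ∑ i, |(u' i : ℝ) - (2 * M + 1) * u i| ≤ U' * (d * (1 / Q)) + 3 * U := by
    calc ∑ i, |(u' i : ℝ) - (2 * M + 1) * u i|
        ≤ ∑ i, (U' * (1 / Q) + (u i / U) * (3 * U)) := by
          refine Finset.sum_le_sum fun i _ => ?_
          have e1 : (u' i : ℝ) - (2 * M + 1) * u i =
            U' * (u' i / U' - u i / U) + (u i / U) * (U' - (2 * M + 1) * U) := by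
            field_simp; ring
          rw [e1]
          refine (abs_add_le _ _).trans ?_
          rw [abs_mul, abs_mul, abs_of_pos hU'1, abs_of_nonneg (by positivity : 0 ≤ (u i : ℝ) / U)]
          gcongr
          exact close i
      _ = _ := by
          rw [Finset.sum_add_distrib, ← Finset.sum_mul (f := fun i => (u i : ℝ) / U), sumU, Finset.sum_const, Finset.card_univ,
            nsmul_eq_mul]
          ring
  have hc : c ≤ lam * U / 4 := by
    rw [div_le_iff₀ hl] at hU2
    have := le_abs_self c
    linarith
  have hQ' : e * d * (1 / Q) ≤ lam / 8 := by
    rw [div_lt_iff₀ hl] at hQ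
    rw [mul_one_div, div_le_iff₀ hQ0]
    linarith
  have h6 : 6 * e < lam * N := by
    have : 6 * e / lam < N := by linarith
    rw [div_lt_iff₀ hl] at this; linarith
  calc e * ∑ i, |(u' i : ℝ) - (2 * M + 1) * u i| ≤ e * (U' * (d * (1 / Q)) + 3 * U) := by gcongr
    _ = U' * (e * d * (1 / Q)) + 3 * e * U := by ring
    _ ≤ U' * (lam / 8) + 3 * e * U := by gcongr
    _ ≤ ((N + 1) * (2 * U)) * (lam / 8) + 3 * e * U := by gcongr
    _ < (N + 1) * (lam * U * (3 / 4)) := by nlinarith [mul_pos hl (by linarith : 0 < U)]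
    _ ≤ (M + 1) * (lam * U - c) := by
      gcongr
      linarith


open Height AdmissibleAbsValues in
lemma bs_abv_le {K : Type*} [Field K] [AdmissibleAbsValues K] (v : AbsoluteValue K ℝ)
    (hv : v ∈ archAbsVal (K := K)) (x : Fin 3 → K) (h2 : x 2 = 1) : v (x 0) ≤ mulHeight x := by
  have h := mulHeight_comp_le ![(0 : Fin 3), 2] x
  have e1 : x ∘ ![(0 : Fin 3), 2] = ![x 0, 1] := by
    ext i; fin_cases i <;> simp [h2]
  rw [e1, ← mulHeight₁_eq_mulHeight] at h
  refine le_trans ?_ h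
  rw [mulHeight₁_eq]
  obtain ⟨t, ht⟩ := Multiset.exists_cons_of_mem hv
  rw [ht, Multiset.map_cons, Multiset.prod_cons]
  have h3 : 1 ≤ (t.map fun v ↦ max (v (x 0)) 1).prod :=
    Multiset.one_le_prod_map fun _ _ ↦ le_max_right ..
  have h4 : 1 ≤ ∏ᶠ v : nonarchAbsVal (K := K), max (v.val (x 0)) 1 :=
    one_le_finprod fun _ ↦ le_max_right ..
  have h5 : v (x 0) ≤ max (v (x 0)) 1 := le_max_left _ _
  have h6 : 0 ≤ max (v (x 0)) 1 := le_trans zero_le_one (le_max_right _ _)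
  calc v (x 0) ≤ max (v (x 0)) 1 * 1 * 1 := by simpa using h5
    _ ≤ _ := by gcongr

open Height AdmissibleAbsValues in
lemma bs_log_zpow {K : Type*} [Field K] [AdmissibleAbsValues K] (x : Fin 3 → K) (d : ℤ) :
    Real.log (mulHeight (x ^ d)) ≤
      |(d : ℝ)| * (Real.log (mulHeight x) + Real.log (mulHeight x⁻¹)) := by
  have h1 := Real.log_nonneg (one_le_mulHeight x)
  have h2 := Real.log_nonneg (one_le_mulHeight x⁻¹)
  obtain ⟨n, rfl | rfl⟩ := d.eq_nat_or_neg
  · rw [zpow_natCast, mulHeight_pow, Real.log_pow]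
    simp only [Int.cast_natCast, Nat.abs_cast]
    gcongr; linarith
  · rw [zpow_neg, ← inv_zpow, zpow_natCast, mulHeight_pow, Real.log_pow]
    simp only [Int.cast_neg, Int.cast_natCast, abs_neg, Nat.abs_cast]
    gcongr; linarith

open Height AdmissibleAbsValues in
lemma bs_log_mul {K : Type*} [Field K] [AdmissibleAbsValues K] (x y : Fin 3 → K) :
    Real.log (mulHeight (x * y)) ≤ Real.log (mulHeight x) + Real.log (mulHeight y) := by
  rw [← Real.log_mul (mulHeight_ne_zero _) (mulHeight_ne_zero _)]
  exact Real.log_le_log (mulHeight_pos _) (mulHeight_mul_le _ _)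

open Height AdmissibleAbsValues in
lemma bs_log_prod {K : Type*} [Field K] [AdmissibleAbsValues K] {ι : Type*} (s : Finset ι)
    (x : ι → Fin 3 → K) :
    Real.log (mulHeight (∏ i ∈ s, x i)) ≤ ∑ i ∈ s, Real.log (mulHeight (x i)) := by
  classical
  induction s using Finset.induction_on with
  | empty => simp
  | insert a s ha ih =>
    rw [Finset.prod_insert ha, Finset.sum_insert ha]
    exact (bs_log_mul _ _).trans (by linarith)

open Height AdmissibleAbsValues in
theorem bs_core {K : Type*} [Field K] [CharZero K] [AdmissibleAbsValues K] {ι : Type*} [Fintype ι]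
    (v : AbsoluteValue K ℝ) (hv : v ∈ archAbsVal (K := K)) (g h : ι → K)
    (hg : ∀ i, 1 < v (g i)) (hh : ∀ i, h i ≠ 0) (β γ : K) (hβ : β ≠ 0) (hγ : γ ≠ 0) :
    {n : ι → ℕ | β * ∏ i, g i ^ n i + γ * ∏ i, h i ^ n i = 1}.Finite := by
  by_contra hinf
  change Set.Infinite _ at hinf
  have hg0 (i : ι) : g i ≠ 0 := by
    intro h0
    have := hg i
    rw [h0, map_zero] at this
    linarith
  obtain ⟨lam, hlam, hlam'⟩ : ∃ lam : ℝ, 0 < lam ∧ ∀ i, lam ≤ Real.log (v (g i)) := by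
    rcases isEmpty_or_nonempty ι with hι | hι
    · exact ⟨1, one_pos, fun i => (hι.false i).elim⟩
    · obtain ⟨i, hi⟩ := Finite.exists_min fun i => Real.log (v (g i))
      exact ⟨_, Real.log_pos (hg i), hi⟩
  let b : Fin 3 → K := ![-β, -γ, 1]
  let G : ι → Fin 3 → K := fun i => ![g i, h i, 1]
  let X : (ι → ℕ) → Fin 3 → K := fun u => b * ∏ i, G i ^ u i
  have X0 (u) : X u 0 = -(β * ∏ i, g i ^ u i) := by simp [X, b, G]
  have X1 (u) : X u 1 = -(γ * ∏ i, h i ^ u i) := by simp [X, b, G]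
  have X2 (u) : X u 2 = 1 := by simp [X, b, G]
  have Xne (u) (i) : X u i ≠ 0 := by
    fin_cases i
    · change X u 0 ≠ 0
      rw [X0]
      exact neg_ne_zero.2 (mul_ne_zero hβ (Finset.prod_ne_zero_iff.2 fun i _ => pow_ne_zero _ (hg0 i)))
    · change X u 1 ≠ 0
      rw [X1]
      exact neg_ne_zero.2 (mul_ne_zero hγ (Finset.prod_ne_zero_iff.2 fun i _ => pow_ne_zero _ (hh i)))
    · change X u 2 ≠ 0
      rw [X2]; exact one_ne_zero
  let e : ℝ := Real.log (mulHeight b⁻¹) +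
    ∑ i, (Real.log (mulHeight (G i)) + Real.log (mulHeight (G i)⁻¹))
  have nn (x : Fin 3 → K) : 0 ≤ Real.log (mulHeight x) := Real.log_nonneg (one_le_mulHeight x)
  have hs : 0 ≤ ∑ i, (Real.log (mulHeight (G i)) + Real.log (mulHeight (G i)⁻¹)) :=
    Finset.sum_nonneg fun i _ => add_nonneg (nn _) (nn _)
  have he : 0 ≤ e := add_nonneg (nn _) hs
  have he1 : Real.log (mulHeight b⁻¹) ≤ e := le_add_of_nonneg_right hs
  have he2 (i : ι) : Real.log (mulHeight (G i)) + Real.log (mulHeight (G i)⁻¹) ≤ e :=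
    le_add_of_nonneg_of_le (nn _) (Finset.single_le_sum
      (f := fun i => Real.log (mulHeight (G i)) + Real.log (mulHeight (G i)⁻¹))
      (fun i _ => add_nonneg (nn _) (nn _)) (Finset.mem_univ i))
  set c0 : ℝ := - Real.log (v β) with hc0
  have low (u : ι → ℕ) : lam * ((∑ i, u i : ℕ) : ℝ) - c0 ≤ Real.log (v (X u 0)) := by
    rw [X0, v.map_neg, map_mul, map_prod, Real.log_mul (by simpa using hβ)
      (Finset.prod_ne_zero_iff.2 fun i _ => by simpa using fun h => (hg0 i h).elim),
      Real.log_prod (fun i _ => by simpa using fun h => (hg0 i h).elim)]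
    have : lam * ((∑ i, u i : ℕ) : ℝ) ≤ ∑ i, Real.log (v (g i ^ u i)) := by
      rw [Nat.cast_sum, Finset.mul_sum]
      refine Finset.sum_le_sum fun i _ => ?_
      rw [map_pow, Real.log_pow, mul_comm]
      gcongr
      exact hlam' i
    linarith
  have low2 (u : ι → ℕ) : lam * ((∑ i, u i : ℕ) : ℝ) - c0 ≤ Real.log (mulHeight (X u)) :=
    (low u).trans (Real.log_le_log (v.pos (Xne u 0)) (bs_abv_le v hv (X u) (X2 u)))
  set c : ℝ := c0 + totalWeight K * Real.log 16 + 2 * e with hc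
  obtain ⟨u, hu, u', hu', N, hR, hM⟩ := bs_comb _ hinf lam e c hlam he ((c0 + 1) / lam)
  rw [div_le_iff₀ hlam] at hR
  have sum0 (u : ι → ℕ) (hu : β * ∏ i, g i ^ u i + γ * ∏ i, h i ^ u i = 1) :
      X u 0 + X u 1 + X u 2 = 0 := by
    rw [X0, X1, X2, ← hu]; ring
  have hq : X u 0 ^ 2 + X u 0 * X u 1 + X u 1 ^ 2 ≠ 0 := by
    intro h0
    have h1 := sum0 u hu
    have h2 := X2 u
    have h3 : X u 0 ^ 3 = 1 := by
      rw [h2] at h1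
      have : X u 1 = -1 - X u 0 := by linear_combination h1
      rw [this] at h0
      linear_combination (X u 0 - 1) * h0
    have h4 : v (X u 0) ^ 3 = 1 := by rw [← map_pow, h3, map_one]
    have h5 : 3 * Real.log (v (X u 0)) = 0 := by
      have := congrArg Real.log h4
      rw [Real.log_pow, Real.log_one] at this
      exact_mod_cast this
    have := low u
    linarith
  obtain ⟨M, hMN, hkey⟩ := bs_key (X u) (X u') (Xne u) (Xne u') (sum0 u hu) (sum0 u' hu') hq N
  have hlt := hM M hMN
  have hquot : X u' / X u ^ (2 * M + 1) =
      b⁻¹ ^ (2 * M) * ∏ i, G i ^ ((u' i : ℤ) - (2 * M + 1) * u i) := by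
    have Gne (i : ι) (j) : G i j ≠ 0 := by
      fin_cases j
      · exact hg0 i
      · exact hh i
      · exact one_ne_zero
    have bne (j) : b j ≠ 0 := by
      fin_cases j
      · exact neg_ne_zero.2 hβ
      · exact neg_ne_zero.2 hγ
      · exact one_ne_zero
    ext j
    have e1 : ∏ i, G i j ^ ((u' i : ℤ) - (2 * M + 1) * u i) =
        (∏ i, G i j ^ u' i) / (∏ i, G i j ^ u i) ^ (2 * M + 1) := by
      rw [← Finset.prod_pow, ← Finset.prod_div_distrib]
      refine Finset.prod_congr rfl fun i _ => ?_
      rw [zpow_sub₀ (Gne i j), zpow_natCast, ← pow_mul, ← zpow_natCast (G i j) (u i * _)]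
      congr 2
      push_cast; ring
    simp only [X, Pi.div_apply, Pi.mul_apply, Pi.pow_apply, Finset.prod_apply, Pi.inv_apply]
    rw [e1, mul_pow, pow_succ (b j), inv_pow]
    have := bne j
    have h2 : ∏ i, G i j ^ u i ≠ 0 := Finset.prod_ne_zero_iff.2 fun i _ => pow_ne_zero _ (Gne i j)
    field_simp
  have up : Real.log (mulHeight (X u' / X u ^ (2 * M + 1))) ≤
      2 * M * e + e * ∑ i, |(u' i : ℝ) - (2 * M + 1) * u i| := by
    rw [hquot]
    refine (bs_log_mul _ _).trans ?_
    apply add_le_add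
    · rw [mulHeight_pow, Real.log_pow]
      push_cast
      gcongr
    · refine (bs_log_prod _ _).trans ?_
      rw [Finset.mul_sum]
      refine Finset.sum_le_sum fun i _ => ?_
      refine (bs_log_zpow _ _).trans ?_
      push_cast
      rw [mul_comm]
      gcongr
      exact he2 i
  have hkey' := Real.log_le_log (pow_pos (mulHeight_pos _) _) hkey
  rw [Real.log_pow, Real.log_mul (by positivity) (mulHeight_ne_zero _), Real.log_pow,
    Real.log_mul (by norm_num) (by positivity), Real.log_pow] at hkey'
  push_cast at hkey'
  have l2 : Real.log 2 ≤ Real.log 16 := Real.log_le_log (by norm_num) (by norm_num)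
  have t0 : (0 : ℝ) ≤ totalWeight K := Nat.cast_nonneg _
  have h7 : ((M : ℝ) + 1) * (lam * ((∑ i, u i : ℕ) : ℝ) - c0) ≤
    (M + 1) * Real.log (mulHeight (X u)) := by
    gcongr
    exact low2 u
  have h8 : (totalWeight K : ℝ) * (Real.log 2 + M * Real.log 16) ≤
    totalWeight K * ((M + 1) * Real.log 16) := by
    gcongr
    linarith
  rw [hc] at hlt
  nlinarith

theorem bs_core_nf {K : Type*} [Field K] [NumberField K] {ι : Type*} [Fintype ι]
    (φ : K →+* ℂ) (g h : ι → K)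
    (hg : ∀ i, 1 < ‖φ (g i)‖) (hh : ∀ i, h i ≠ 0) (β γ : K) (hβ : β ≠ 0) (hγ : γ ≠ 0) :
    {n : ι → ℕ | β * ∏ i, g i ^ n i + γ * ∏ i, h i ^ n i = 1}.Finite := by
  refine bs_core (NumberField.InfinitePlace.mk φ).1 ?_ g h ?_ hh β γ hβ hγ
  · exact NumberField.mem_multisetInfinitePlace.2 (NumberField.InfinitePlace.mk φ).2
  · exact hg

theorem bs_complex {ι : Type*} [Fintype ι] (g h : ι → ℂ) (hg : ∀ i, 1 < ‖g i‖)
    (hh : ∀ i, h i ≠ 0) (β γ : ℂ) (hβ : β ≠ 0) (hγ : γ ≠ 0)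
    (ga : ∀ i, IsAlgebraic ℚ (g i)) (ha : ∀ i, IsAlgebraic ℚ (h i))
    (βa : IsAlgebraic ℚ β) (γa : IsAlgebraic ℚ γ) :
    {n : ι → ℕ | β * ∏ i, g i ^ n i + γ * ∏ i, h i ^ n i = 1}.Finite := by
  let T : Set ℂ := (Set.range g ∪ Set.range h) ∪ {β, γ}
  have hT : T.Finite := ((Set.finite_range g).union (Set.finite_range h)).union (Set.toFinite _)
  have hTi : ∀ x ∈ T, IsIntegral ℚ x := by
    rintro x ((⟨i, rfl⟩ | ⟨i, rfl⟩) | rfl | rfl)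
    · exact (ga i).isIntegral
    · exact (ha i).isIntegral
    · exact βa.isIntegral
    · exact γa.isIntegral
  let K := IntermediateField.adjoin ℚ T
  haveI : Finite T := hT
  haveI : FiniteDimensional ℚ K := IntermediateField.finiteDimensional_adjoin hTi
  haveI : NumberField K := { to_charZero := inferInstance, to_finiteDimensional := this }
  have mem {x} (hx : x ∈ T) : x ∈ K := IntermediateField.subset_adjoin ℚ T hx
  let g' : ι → K := fun i => ⟨g i, mem (Or.inl (Or.inl ⟨i, rfl⟩))⟩
  let h' : ι → K := fun i => ⟨h i, mem (Or.inl (Or.inr ⟨i, rfl⟩))⟩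
  let β' : K := ⟨β, mem (Or.inr (Or.inl rfl))⟩
  let γ' : K := ⟨γ, mem (Or.inr (Or.inr rfl))⟩
  have := bs_core_nf (algebraMap K ℂ) g' h' hg
    (fun i h0 => hh i (congrArg Subtype.val h0)) β' γ'
    (fun h0 => hβ (congrArg Subtype.val h0)) (fun h0 => hγ (congrArg Subtype.val h0))
  refine this.subset fun n hn => ?_
  change β' * ∏ i, g' i ^ n i + γ' * ∏ i, h' i ^ n i = 1
  apply Subtype.ext
  push_cast
  exact hn

lemma bs_alg_complex {x y : ℝ} (hx : IsAlgebraic ℚ x) (hy : IsAlgebraic ℚ y) :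
    IsAlgebraic ℚ (⟨x, y⟩ : ℂ) := by
  have e : (⟨x, y⟩ : ℂ) = algebraMap ℝ ℂ x + algebraMap ℝ ℂ y * Complex.I := by
    apply Complex.ext <;> simp
  rw [e]
  have hI : IsAlgebraic ℚ Complex.I := by
    refine IsIntegral.isAlgebraic ⟨Polynomial.X ^ 2 + 1, ?_, ?_⟩
    · exact Polynomial.monic_X_pow_add_C (R := ℚ) 1 two_ne_zero
    · simp
  exact (hx.algebraMap).add ((hy.algebraMap).mul hI)

lemma bs_algQuat_mul {p q : ℍ[ℝ]} (hp : AlgQuat p) (hq : AlgQuat q) : AlgQuat (p * q) := by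
  obtain ⟨a1, a2, a3, a4⟩ := hp
  obtain ⟨b1, b2, b3, b4⟩ := hq
  refine ⟨?_, ?_, ?_, ?_⟩
  · rw [Quaternion.re_mul]
    exact (((a1.mul b1).sub (a2.mul b2)).sub (a3.mul b3)).sub (a4.mul b4)
  · rw [Quaternion.imI_mul]
    exact (((a1.mul b2).add (a2.mul b1)).add (a3.mul b4)).sub (a4.mul b3)
  · rw [Quaternion.imJ_mul]
    exact (((a1.mul b3).sub (a2.mul b4)).add (a3.mul b1)).add (a4.mul b2)
  · rw [Quaternion.imK_mul]
    exact (((a1.mul b4).add (a2.mul b3)).sub (a3.mul b2)).add (a4.mul b1)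

lemma bs_exists_axis (S : Finset ℍ[ℝ]) (hS : ∀ g ∈ S, AlgQuat g)
    (hcomm : ∀ x ∈ S, ∀ y ∈ S, x * y = y * x) :
    ∃ n1 n2 n3 : ℝ, IsAlgebraic ℚ n1 ∧ IsAlgebraic ℚ n2 ∧ IsAlgebraic ℚ n3 ∧
      n1 ^ 2 + n2 ^ 2 + n3 ^ 2 = 1 ∧
      ∀ g ∈ S, ∃ t : ℝ, g.imI = t * n1 ∧ g.imJ = t * n2 ∧ g.imK = t * n3 := by
  by_cases hr : ∀ g ∈ S, g.imI = 0 ∧ g.imJ = 0 ∧ g.imK = 0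
  · exact ⟨1, 0, 0, isAlgebraic_one, isAlgebraic_zero, isAlgebraic_zero, by norm_num,
      fun g hg => ⟨0, by simpa using hr g hg⟩⟩
  · push Not at hr
    obtain ⟨q, hq, hq0⟩ := hr
    obtain ⟨-, a2, a3, a4⟩ := hS q hq
    have hpos : 0 < q.imI ^ 2 + q.imJ ^ 2 + q.imK ^ 2 := by
      by_contra hcon
      have h1 : q.imI = 0 := by nlinarith [sq_nonneg q.imI, sq_nonneg q.imJ, sq_nonneg q.imK]
      have h2 : q.imJ = 0 := by nlinarith [sq_nonneg q.imI, sq_nonneg q.imJ, sq_nonneg q.imK]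
      have h3 : q.imK = 0 := by nlinarith [sq_nonneg q.imI, sq_nonneg q.imJ, sq_nonneg q.imK]
      exact hq0 h1 h2 h3
    set r : ℝ := Real.sqrt (q.imI ^ 2 + q.imJ ^ 2 + q.imK ^ 2) with hr
    have hr2 : r ^ 2 = q.imI ^ 2 + q.imJ ^ 2 + q.imK ^ 2 := Real.sq_sqrt hpos.le
    have hr0 : r ≠ 0 := (Real.sqrt_pos.2 hpos).ne'
    have ra : IsAlgebraic ℚ r := by
      refine IsAlgebraic.of_pow two_pos ?_
      rw [hr2]
      exact ((a2.pow 2).add (a3.pow 2)).add (a4.pow 2)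
    refine ⟨q.imI / r, q.imJ / r, q.imK / r, ?_, ?_, ?_, ?_, ?_⟩
    · rw [div_eq_mul_inv]; exact a2.mul ra.inv
    · rw [div_eq_mul_inv]; exact a3.mul ra.inv
    · rw [div_eq_mul_inv]; exact a4.mul ra.inv
    · field_simp; exact hr2.symm
    · intro g hg
      have hc := hcomm g hg q hq
      have c1 := congrArg QuaternionAlgebra.imI hc
      have c2 := congrArg QuaternionAlgebra.imJ hc
      have c3 := congrArg QuaternionAlgebra.imK hc
      rw [Quaternion.imI_mul, Quaternion.imI_mul] at c1
      rw [Quaternion.imJ_mul, Quaternion.imJ_mul] at c2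
      rw [Quaternion.imK_mul, Quaternion.imK_mul] at c3
      refine ⟨(g.imI * q.imI + g.imJ * q.imJ + g.imK * q.imK) / r, ?_, ?_, ?_⟩
      · field_simp
        rw [hr2]
        linear_combination (q.imJ / 2) * c3 - (q.imK / 2) * c2
      · field_simp
        rw [hr2]
        linear_combination (-q.imI / 2) * c3 + (q.imK / 2) * c1
      · field_simp
        rw [hr2]
        linear_combination (q.imI / 2) * c2 - (q.imJ / 2) * c1

theorem commutative_unit_norm_equation (S : Finset ℍ[ℝ])
    (hS : ∀ g ∈ S, AlgQuat g ∧ 1 < ‖g‖)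
    (hcomm : ∀ x ∈ Subsemigroup.closure (S : Set ℍ[ℝ]),
      ∀ y ∈ Subsemigroup.closure (S : Set ℍ[ℝ]), x * y = y * x)
    (a a' : ℍ[ℝ]) (ha : a ≠ 0) (ha' : a' ≠ 0) (haA : AlgQuat a) (haA' : AlgQuat a') :
    {f : ℍ[ℝ] | f ∈ Subsemigroup.closure (S : Set ℍ[ℝ]) ∧
      ‖1 - a * f * a'‖ = ‖a * f * a'‖}.Finite := by
  classical
  have hsub : ∀ x ∈ S, x ∈ Subsemigroup.closure (S : Set ℍ[ℝ]) := fun x hx =>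
    Subsemigroup.subset_closure hx
  obtain ⟨n1, n2, n3, N1, N2, N3, hn, hax⟩ := bs_exists_axis S (fun g hg => (hS g hg).1)
    (fun x hx y hy => hcomm x (hsub x hx) y (hsub y hy))
  let ψ : ℍ[ℝ] → ℂ := fun q => ⟨q.re, q.imI * n1 + q.imJ * n2 + q.imK * n3⟩
  let rec' : ℂ → ℍ[ℝ] := fun z => ⟨z.re, z.im * n1, z.im * n2, z.im * n3⟩
  have ψa {q : ℍ[ℝ]} (hq : AlgQuat q) : IsAlgebraic ℚ (ψ q) :=
    bs_alg_complex hq.1 (((hq.2.1.mul N1).add (hq.2.2.1.mul N2)).add (hq.2.2.2.mul N3))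
  have conja {z : ℂ} (hz : IsAlgebraic ℚ z) : IsAlgebraic ℚ ((starRingEnd ℂ) z) :=
    hz.algHom (Complex.conjAe.toAlgHom.restrictScalars ℚ)
  let L : ℍ[ℝ] → Prop := fun g => ∃ t : ℝ, g.imI = t * n1 ∧ g.imJ = t * n2 ∧ g.imK = t * n3
  have Lψ {g : ℍ[ℝ]} {t : ℝ} (h : g.imI = t * n1 ∧ g.imJ = t * n2 ∧ g.imK = t * n3) :
      ψ g = ⟨g.re, t⟩ := by
    apply Complex.ext
    · rfl
    · simp only [ψ, h.1, h.2.1, h.2.2]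
      linear_combination t * hn
  have Lrec {g : ℍ[ℝ]} (h : L g) : rec' (ψ g) = g := by
    obtain ⟨t, ht⟩ := h
    rw [Lψ ht]
    ext
    · rfl
    · exact ht.1.symm
    · exact ht.2.1.symm
    · exact ht.2.2.symm
  have Lmul {x y : ℍ[ℝ]} (hx : L x) (hy : L y) : L (x * y) ∧ ψ (x * y) = ψ x * ψ y := by
    obtain ⟨s, hs⟩ := hx
    obtain ⟨t, ht⟩ := hy
    have key : (x * y).imI = (x.re * t + s * y.re) * n1 ∧ (x * y).imJ = (x.re * t + s * y.re) * n2 ∧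
        (x * y).imK = (x.re * t + s * y.re) * n3 := by
      rw [Quaternion.imI_mul, Quaternion.imJ_mul, Quaternion.imK_mul, hs.1, hs.2.1, hs.2.2, ht.1,
        ht.2.1, ht.2.2]
      refine ⟨by ring, by ring, by ring⟩
    refine ⟨⟨_, key⟩, ?_⟩
    rw [Lψ key, Lψ hs, Lψ ht]
    apply Complex.ext
    · simp only [Complex.mul_re]
      rw [Quaternion.re_mul, hs.1, hs.2.1, hs.2.2, ht.1, ht.2.1, ht.2.2]
      linear_combination (-s * t) * hn
    · simp only [Complex.mul_im]
  have norm_gt {g : ℍ[ℝ]} (hg : L g) (h1 : 1 < ‖g‖) : 1 < ‖ψ g‖ := by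
    obtain ⟨t, ht⟩ := hg
    have e : ‖ψ g‖ * ‖ψ g‖ = ‖g‖ * ‖g‖ := by
      rw [← Quaternion.normSq_eq_norm_mul_self, Quaternion.normSq_def', ← sq, ← Complex.normSq_eq_norm_sq,
        Lψ ht, Complex.normSq_mk, ht.1, ht.2.1, ht.2.2]
      linear_combination (-t ^ 2) * hn
    nlinarith [norm_nonneg (ψ g)]
  have repr (f : ℍ[ℝ]) (hf : f ∈ Subsemigroup.closure (S : Set ℍ[ℝ])) :
      L f ∧ ∃ m : S → ℕ, ψ f = ∏ s, ψ s.1 ^ m s := by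
    induction hf using Subsemigroup.closure_induction with
    | mem x hx =>
      refine ⟨hax x hx, Pi.single ⟨x, hx⟩ 1, ?_⟩
      rw [Finset.prod_eq_single (⟨x, hx⟩ : S)]
      · simp
      · intro b _ hb
        simp [Pi.single_eq_of_ne hb]
      · simp
    | mul x y _ _ hx hy =>
      obtain ⟨hx, m, hm⟩ := hx
      obtain ⟨hy, k, hk⟩ := hy
      refine ⟨(Lmul hx hy).1, m + k, ?_⟩
      rw [(Lmul hx hy).2, hm, hk, ← Finset.prod_mul_distrib]
      simp [pow_add]
  set β : ℂ := ψ (a' * a) with hβ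
  have sol (f : ℍ[ℝ]) (hf : L f) (h : ‖1 - a * f * a'‖ = ‖a * f * a'‖) :
      β * ψ f + (starRingEnd ℂ) (β * ψ f) = 1 := by
    have h1 : (a * f * a').re = 1 / 2 := by
      have h2 : ‖1 - a * f * a'‖ * ‖1 - a * f * a'‖ = ‖a * f * a'‖ * ‖a * f * a'‖ := by rw [h]
      rw [← Quaternion.normSq_eq_norm_mul_self, ← Quaternion.normSq_eq_norm_mul_self,
        Quaternion.normSq_def', Quaternion.normSq_def'] at h2
      simp only [Quaternion.re_sub, Quaternion.imI_sub, Quaternion.imJ_sub, Quaternion.imK_sub,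
        Quaternion.re_one, Quaternion.imI_one, Quaternion.imJ_one, Quaternion.imK_one] at h2
      linarith
    have h2 : (a * f * a').re = ((a' * a) * f).re := by
      simp only [Quaternion.re_mul, Quaternion.imI_mul, Quaternion.imJ_mul, Quaternion.imK_mul]
      ring
    have h3 : ((a' * a) * f).re = (β * ψ f).re := by
      obtain ⟨t, ht⟩ := hf
      rw [Lψ ht, Quaternion.re_mul, ht.1, ht.2.1, ht.2.2, hβ]
      simp only [ψ, Complex.mul_re]
      ring
    rw [Complex.add_conj, ← h3, ← h2, h1]
    norm_num
  by_cases hβ0 : β = 0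
  · convert Set.finite_empty
    rw [Set.eq_empty_iff_forall_notMem]
    rintro f ⟨hf, h⟩
    have := sol f (repr f hf).1 h
    rw [hβ0] at this
    simp at this
  have hfin := bs_complex (fun s : S => ψ s.1) (fun s : S => (starRingEnd ℂ) (ψ s.1))
    (fun s => norm_gt (hax _ s.2) (hS _ s.2).2)
    (fun s h0 => by
      have h1 := norm_gt (hax _ s.2) (hS _ s.2).2
      have h2 : ψ s.1 = 0 := by simpa using h0
      rw [h2, norm_zero] at h1
      linarith) β ((starRingEnd ℂ) β) hβ0 (by simpa using hβ0)
    (fun s => ψa (hS _ s.2).1) (fun s => conja (ψa (hS _ s.2).1))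
    (ψa (bs_algQuat_mul haA' haA)) (conja (ψa (bs_algQuat_mul haA' haA)))
  refine (hfin.image fun m => rec' (∏ s : S, ψ s.1 ^ m s)).subset ?_
  rintro f ⟨hf, h⟩
  obtain ⟨hL, m, hm⟩ := repr f hf
  refine ⟨m, ?_, ?_⟩
  · have := sol f hL h
    rw [hm] at this
    simpa using this
  · show rec' _ = f
    rw [← hm]
    exact Lrec hL
end

section
/- Let Γ₁, Γ₂ be semigroups of nonzero algebraic quaternions each generated by finitely many elements of norm greater than 1, and fix nonzero algebraic quaternions a, a', b, b'. Then there are only finitely many pairs (f, g) ∈ Γ₁ × Γ₂ with a f a' + b g b' = 1 and |1 − a f a'| ≠ |a f a'|. -/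
open Quaternion

open Finset Polynomial in
lemma aux_div (e k : ℕ) (he : 1 ≤ e) (x : ℤ) :
    ((k.factorial : ℕ) : ℤ) ∣ ((2:ℤ)^e)^k * ∏ h ∈ range k, (x - (2:ℤ)^e * h) := by
  obtain ⟨v, B, hB, hk⟩ := Nat.exists_eq_two_pow_mul_odd (Nat.factorial_ne_zero k)
  have hv : v ≤ k := by
    have h1 := sub_one_mul_padicValNat_factorial (p := 2) k
    have h2 : (2:ℕ)^v ∣ k.factorial := ⟨B, hk⟩
    have h3 := (padicValNat_dvd_iff_le (p := 2) (Nat.factorial_ne_zero k)).1 h2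
    omega
  have hcop : IsCoprime ((2:ℤ)^e) (B:ℤ) := by
    apply IsCoprime.pow_left
    have : Nat.Coprime 2 B := (Nat.coprime_two_left).2 hB
    exact_mod_cast Nat.isCoprime_iff_coprime.2 this
  have hBd : (B:ℤ) ∣ ∏ h ∈ range k, (x - (2:ℤ)^e * h) := by
    obtain ⟨a, b, hab⟩ := hcop
    have h1 : (∏ h ∈ range k, (x - (2:ℤ)^e * h)) ≡ ∏ h ∈ range k, ((2:ℤ)^e * (a * x - h)) [ZMOD B] := by
      apply Int.ModEq.prod
      intro h _
      apply Int.modEq_iff_dvd.2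
      refine ⟨- (b * x), ?_⟩
      linear_combination x * hab
    have h2 : (B:ℤ) ∣ ∏ h ∈ range k, ((2:ℤ)^e * (a * x - h)) := by
      rw [prod_mul_distrib]
      apply Dvd.dvd.mul_left
      rw [← descPochhammer_eval_eq_prod_range]
      have h3 := Ring.descPochhammer_eq_factorial_smul_choose (a*x) k
      rw [← Polynomial.eval_eq_smeval] at h3
      rw [h3, hk]
      simp only [nsmul_eq_mul]
      push_cast
      exact ⟨2^v * Ring.choose (a*x) k, by ring⟩
    exact (Int.ModEq.dvd_iff h1).2 h2
  rw [hk]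
  push_cast
  apply mul_dvd_mul _ hBd
  rw [← pow_mul]
  exact pow_dvd_pow _ (by nlinarith)

open Finset in
lemma aux_full (n d : ℕ) :
    ∏ t ∈ (range (n + d + 1)).erase n, ((n:ℤ) - t) = (-1)^d * n.factorial * d.factorial := by
  induction d with
  | zero =>
    simp only [add_zero, range_add_one, pow_zero, Nat.factorial_zero]
    rw [erase_insert (by simp)]
    have := Finset.prod_range_reflect (fun t => ((t:ℤ)+1)) n
    rw [← Finset.prod_range_add_one_eq_factorial]
    push_cast
    rw [← this, one_mul, mul_one]
    apply prod_congr rfl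
    intro t ht
    have := mem_range.1 ht
    push_cast [Nat.sub_sub, Nat.cast_sub (show 1 + t ≤ n by omega)]
    ring
  | succ d ih =>
    rw [← add_assoc, range_add_one (n := n+d+1), erase_insert_of_ne (by omega), prod_insert (by simp), ih,
      Nat.factorial_succ]
    push_cast
    ring

open Finset Polynomial in
lemma aux_weights (e s : ℕ) (he : 1 ≤ e) (hs : s + 1 ≤ 2^e) : ∃ c : ℝ, 1 ≤ c ∧ ∀ k : ℕ, ∃ C : ℕ × ℕ → ℤ,
    (∀ p ∈ range (s+1) ×ˢ range (k+1), C p ≠ 0) ∧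
    (∀ p ∈ range (s+1) ×ˢ range (k+1), (|C p| : ℝ) ≤ c^(k+1)) ∧
    ∀ q : ℝ[X], q.degree < ((s+1)*(k+1) - 1 : ℕ) →
      ∑ p ∈ range (s+1) ×ˢ range (k+1), (C p : ℝ) * q.eval ((p.1 + 2^e * p.2 : ℕ) : ℝ) = 0 := by
  set m : ℕ := 2^e with hm
  have hm1 : 1 ≤ m := Nat.one_le_two_pow
  set r := m - (s+1) with hr
  refine ⟨2^m * (m * m * Real.exp 1)^r, ?_, ?_⟩
  · apply one_le_mul_of_one_le_of_one_le
    · exact one_le_pow₀ (by norm_num)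
    · apply one_le_pow₀
      have : (1:ℝ) ≤ m := by exact_mod_cast hm1
      have := Real.one_le_exp (zero_le_one)
      apply one_le_mul_of_one_le_of_one_le _ this
      nlinarith
  intro k
  set K := k + 1 with hK
  set v : ℕ × ℕ → ℕ := fun p => p.1 + m * p.2 with hv
  set P := range (s+1) ×ˢ range K with hP
  set U := range m ×ˢ range K with hU
  set Q := Ico (s+1) m ×ˢ range K with hQ
  set M := m * K - 1 with hM
  have hmK : M + 1 = m * K := by
    have : 1 ≤ m * K := Nat.one_le_iff_ne_zero.2 (by positivity)
    omega
  have hPU : P ⊆ U := by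
    apply product_subset_product _ subset_rfl
    intro x; simp; omega
  have hUPQ : U = P.disjUnion Q (by
      rw [Finset.disjoint_left]; intro x; simp [hP, hQ]; omega) := by
    ext x; simp [hP, hQ, hU]; omega
  have hvinj : Set.InjOn v U := by
    rintro ⟨a, b⟩ h1 ⟨a', b'⟩ h2 h
    simp [hU] at h1 h2
    simp only [hv] at h
    have e1 : a = a' := by
      have := congrArg (· % m) h
      simpa [Nat.mod_eq_of_lt h1.1, Nat.mod_eq_of_lt h2.1] using this
    subst e1
    have : m * b = m * b' := by omega
    simp [Nat.eq_of_mul_eq_mul_left (by omega) this]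
  have hvU : ∀ p ∈ U, v p ≤ M := by
    rintro ⟨a, b⟩ h1
    simp [hU] at h1
    have : m * (b + 1) ≤ m * K := Nat.mul_le_mul_left _ (by omega)
    simp only [hv]
    nlinarith
  -- full product
  have hfull : ∀ p ∈ U, ∏ q ∈ U.erase p, ((v p : ℤ) - v q) =
      (-1)^(M - v p) * (v p).factorial * (M - v p).factorial := by
    intro p hp
    rw [← aux_full, show v p + (M - v p) + 1 = m * K by have := hvU p hp; omega]
    apply prod_nbij v
    · intro q hq
      rw [mem_erase] at hq ⊢
      refine ⟨fun h => hq.1 (hvinj hq.2 hp h), ?_⟩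
      have := hvU q hq.2
      rw [mem_range]; omega
    · exact hvinj.mono (by simp)
    · intro t ht
      simp only [coe_erase, Set.mem_sdiff, mem_coe, mem_range, Set.mem_singleton_iff, Set.mem_image] at ht ⊢
      have h0 : v (t % m, t / m) = t := by simp only [hv]; exact Nat.mod_add_div t m
      refine ⟨(t % m, t / m), ⟨?_, ?_⟩, h0⟩
      · simp only [hU, mem_product, mem_range]
        exact ⟨Nat.mod_lt _ hm1, Nat.div_lt_of_lt_mul ht.1⟩
      · intro h; apply ht.2; rw [← h0, h]
    · simp
  -- divisibility
  have hdiv : ∀ j p, ∃ g : ℤ, (m:ℤ)^K * ∏ h ∈ range K, ((v p : ℤ) - v (j, h)) = K.factorial * g := by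
    intro j p
    have := aux_div e K he ((v p : ℤ) - j)
    obtain ⟨g, hg⟩ := this
    refine ⟨g, ?_⟩
    rw [← hg]
    simp only [hm, hv]
    push_cast
    congr 1
    apply prod_congr rfl
    intro h _
    ring
  choose g hg using hdiv
  set G : ℕ × ℕ → ℤ := fun p => ∏ j ∈ Ico (s+1) m, g j p with hG
  have hGF : ∀ p, (K.factorial : ℤ)^r * G p = ((m:ℤ)^K)^r * ∏ q ∈ Q, ((v p : ℤ) - v q) := by
    intro p
    have hc : (Ico (s+1) m).card = r := by simp [hr]
    rw [hQ, prod_product, ← hc, ← prod_const, ← prod_const, ← prod_mul_distrib, ← prod_mul_distrib]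
    exact prod_congr rfl (fun j _ => (hg j p).symm)
  have hgb : ∀ j p, j < m → p ∈ U → |(g j p : ℝ)| ≤ (m * m * Real.exp 1)^K := by
    intro j p hj hp
    have h1 : ((m:ℝ)^K * ∏ h ∈ range K, ((v p : ℝ) - v (j, h))) = K.factorial * g j p := by
      exact_mod_cast hg j p
    have h2 : |∏ h ∈ range K, ((v p : ℝ) - v (j, h))| ≤ ((m * K : ℕ) : ℝ)^K := by
      rw [abs_prod]
      calc _ ≤ ∏ h ∈ range K, ((m * K : ℕ) : ℝ) := by
            apply prod_le_prod
            · intros; positivity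
            · intro h hh
              have a1 := hvU p hp
              have a2 := hvU (j, h) (by simp [hU, hj, mem_range.1 hh])
              have a3 : (v p : ℝ) ≤ (m*K : ℕ) := by exact_mod_cast (by omega)
              have a4 : (v (j,h) : ℝ) ≤ (m*K : ℕ) := by exact_mod_cast (by omega)
              rw [abs_le]
              constructor <;> linarith [Nat.cast_nonneg (α := ℝ) (v p), Nat.cast_nonneg (α := ℝ) (v (j,h))]
        _ = _ := by simp
    have h3 := Real.pow_div_factorial_le_exp K (by positivity) K
    have hf : (0:ℝ) < K.factorial := by exact_mod_cast Nat.factorial_pos K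
    rw [div_le_iff₀ hf] at h3
    have h4 : (K.factorial : ℝ) * |(g j p : ℝ)| ≤ K.factorial * (m * m * Real.exp 1)^K := by
      calc (K.factorial : ℝ) * |(g j p : ℝ)| = |(K.factorial : ℝ) * g j p| := by
            rw [abs_mul, abs_of_pos hf]
        _ = (m:ℝ)^K * |∏ h ∈ range K, ((v p : ℝ) - v (j, h))| := by
            rw [← h1, abs_mul, abs_of_nonneg (by positivity)]
        _ ≤ (m:ℝ)^K * ((m * K : ℕ) : ℝ)^K := by gcongr
        _ = (m*m:ℝ)^K * (K:ℝ)^K := by push_cast; ring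
        _ ≤ (m*m:ℝ)^K * (Real.exp K * K.factorial) := by gcongr
        _ = _ := by
            rw [mul_pow (_ * _), ← Real.exp_nat_mul, mul_one]; ring
    exact le_of_mul_le_mul_left h4 hf
  have hsplit : ∀ p ∈ P, ∏ q ∈ U.erase p, ((v p : ℤ) - v q) =
      (∏ q ∈ P.erase p, ((v p : ℤ) - v q)) * ∏ q ∈ Q, ((v p : ℤ) - v q) := by
    intro p hp
    have : U.erase p = (P.erase p).disjUnion Q (by
      rw [Finset.disjoint_left]; intro x; simp [hP, hQ]; omega) := by
      ext x; simp only [mem_erase, mem_disjUnion, hUPQ]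
      have : x ∈ Q → x ≠ p := by
        rintro h rfl
        simp [hP, hQ] at hp h; omega
      tauto
    rw [this, prod_disjUnion]
  set C : ℕ × ℕ → ℤ := fun p => (-1)^(M - v p) * (M.choose (v p)) * G p with hC
  have hkey : ∀ p ∈ P, (K.factorial : ℤ)^r * (C p * ∏ q ∈ P.erase p, ((v p : ℤ) - v q)) =
      ((m:ℤ)^K)^r * M.factorial := by
    intro p hp
    have h1 := hsplit p hp
    rw [hfull p (hPU hp)] at h1
    have h2 := Nat.choose_mul_factorial_mul_factorial (hvU p (hPU hp))
    have h3 : (M.choose (v p) : ℤ) * (v p).factorial * (M - v p).factorial = M.factorial := by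
      exact_mod_cast h2
    have h4 : ((-1:ℤ)^(M - v p)) * (-1)^(M - v p) = 1 := by
      rw [← mul_pow]; simp
    calc (K.factorial : ℤ)^r * (C p * ∏ q ∈ P.erase p, ((v p : ℤ) - v q))
        = (-1)^(M - v p) * (M.choose (v p)) * ((K.factorial : ℤ)^r * G p) * ∏ q ∈ P.erase p, ((v p : ℤ) - v q) := by
          simp only [hC]; ring
      _ = (-1)^(M - v p) * (M.choose (v p)) * ((m:ℤ)^K)^r * ((∏ q ∈ P.erase p, ((v p : ℤ) - v q)) * ∏ q ∈ Q, ((v p : ℤ) - v q)) := by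
          rw [hGF]; ring
      _ = _ := by
          rw [← h1, ← h3]
          linear_combination ((m:ℤ)^K)^r * (M.choose (v p) : ℤ) * (v p).factorial * (M - v p).factorial * h4
  have hrhs : ((m:ℤ)^K)^r * (M.factorial:ℤ) ≠ 0 := by
    have := Nat.factorial_ne_zero M
    positivity
  refine ⟨C, ?_, ?_, ?_⟩
  · intro p hp h0
    have := hkey p hp
    rw [h0, zero_mul, mul_zero] at this
    exact hrhs this.symm
  · intro p hp
    have hpU := hPU hp
    simp only [hC, hG]
    push_cast
    rw [abs_mul, abs_mul, abs_pow, abs_neg, abs_one, one_pow, one_mul, abs_prod, mul_pow]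
    gcongr
    · rw [Nat.abs_cast, ← pow_mul]
      calc (M.choose (v p) : ℝ) ≤ 2^M := by exact_mod_cast Nat.choose_le_two_pow M (v p)
        _ ≤ 2^(m*K) := pow_le_pow_right₀ (by norm_num) (by omega)
    · calc _ ≤ ∏ j ∈ Ico (s+1) m, (m * m * Real.exp 1)^K := by
            apply prod_le_prod
            · intros; positivity
            · intro j hj
              exact hgb j p (by simp at hj; omega) hpU
        _ = _ := by
            rw [prod_const, Nat.card_Ico, ← pow_mul, ← pow_mul, mul_comm K]
  · intro q hq
    have hcard : #P = (s+1)*K := by simp [hP]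
    have hinjP : Set.InjOn (fun p => (v p : ℝ)) P := by
      intro a ha b hb hab
      exact hvinj (hPU ha) (hPU hb) (Nat.cast_injective (R := ℝ) hab)
    have h1 := Lagrange.coeff_eq_sum hinjP (P := q) (by
      rw [hcard]; refine lt_of_lt_of_le hq ?_; exact_mod_cast Nat.sub_le _ _)
    rw [hcard, Polynomial.coeff_eq_zero_of_degree_lt hq] at h1
    have h2 : ∀ p ∈ P, (C p : ℝ) * q.eval ((v p : ℕ) : ℝ) =
        (((m:ℝ)^K)^r * M.factorial / (K.factorial : ℝ)^r) * (q.eval ((v p : ℕ) : ℝ) / ∏ q ∈ P.erase p, ((v p : ℝ) - v q)) := by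
      intro p hp
      have h3 : (K.factorial : ℝ)^r * (C p * ∏ q ∈ P.erase p, ((v p : ℝ) - v q)) =
        ((m:ℝ)^K)^r * M.factorial := by exact_mod_cast hkey p hp
      have hf : (K.factorial : ℝ) ≠ 0 := by exact_mod_cast Nat.factorial_ne_zero K
      have hD : ∏ q ∈ P.erase p, ((v p : ℝ) - v q) ≠ 0 := by
        intro h0
        rw [h0, mul_zero, mul_zero] at h3
        apply hrhs
        exact_mod_cast h3.symm
      rw [← h3]
      field_simp
    calc _ = ∑ p ∈ P, (C p : ℝ) * q.eval ((v p : ℕ) : ℝ) := rfl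
      _ = _ := sum_congr rfl h2
      _ = 0 := by rw [← mul_sum, ← h1, mul_zero]

open Finset Polynomial in
/-- a sparse polynomial vanishing to order `T` at `1` is small near `1` -/
lemma aux_small {ι : Type*} (P : Finset ι) (v : ι → ℕ) (c : ι → ℝ) (T M : ℕ)
    (hv : ∀ p ∈ P, v p ≤ M)
    (hc : ∀ q : ℝ[X], q.degree < (T : ℕ) → ∑ p ∈ P, c p * q.eval (v p : ℝ) = 0)
    (y : ℝ) (hy : |y - 1| ≤ 1) :
    |∑ p ∈ P, c p * y ^ v p| ≤ |y - 1| ^ T * 2 ^ M * ∑ p ∈ P, |c p| := by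
  have hexp : ∀ p ∈ P, y ^ v p = ∑ i ∈ range (M+1), (y-1)^i * ((v p).choose i : ℝ) := by
    intro p hp
    have h1 : y ^ v p = ((y - 1) + 1) ^ v p := by ring
    rw [h1, add_pow]
    simp only [one_pow, mul_one]
    apply sum_subset
    · intro i; simp; have := hv p hp; omega
    · intro i _ hi
      rw [Nat.choose_eq_zero_of_lt (by simp at hi; omega)]; simp
  have hmom : ∀ i < T, ∑ p ∈ P, c p * ((v p).choose i : ℝ) = 0 := by
    intro i hi
    have h := hc (descPochhammer ℝ i) (by
      rw [Polynomial.degree_eq_natDegree (monic_descPochhammer ℝ i).ne_zero, descPochhammer_natDegree]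
      exact_mod_cast hi)
    simp only [descPochhammer_eval_eq_descFactorial, Nat.descFactorial_eq_factorial_mul_choose] at h
    push_cast at h
    have hf : (i.factorial : ℝ) ≠ 0 := by exact_mod_cast Nat.factorial_ne_zero i
    have h2 : (i.factorial : ℝ) * ∑ p ∈ P, c p * ((v p).choose i : ℝ) = 0 := by
      rw [← h, mul_sum]; apply sum_congr rfl; intros; ring
    exact (mul_eq_zero.1 h2).resolve_left hf
  have hswap : ∑ p ∈ P, c p * y ^ v p = ∑ i ∈ range (M+1), ∑ p ∈ P, (y-1)^i * (c p * ((v p).choose i : ℝ)) := by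
    rw [sum_comm]
    apply sum_congr rfl
    intro p hp
    rw [hexp p hp, mul_sum]
    apply sum_congr rfl
    intros; ring
  rw [hswap]
  calc _ ≤ ∑ i ∈ range (M+1), |∑ p ∈ P, (y-1)^i * (c p * ((v p).choose i : ℝ))| := abs_sum_le_sum_abs _ _
    _ ≤ ∑ i ∈ range (M+1), ∑ p ∈ P, |y-1|^T * |c p| * ((v p).choose i : ℝ) := by
        apply sum_le_sum
        intro i _
        by_cases hi : i < T
        · rw [← mul_sum, hmom i hi]
          simp only [mul_zero, abs_zero]
          positivity
        · refine (abs_sum_le_sum_abs _ _).trans ?_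
          apply sum_le_sum
          intro p _
          rw [abs_mul, abs_mul, Nat.abs_cast, abs_pow, ← mul_assoc]
          have : |y-1|^i ≤ |y-1|^T := pow_le_pow_of_le_one (abs_nonneg _) hy (by omega)
          gcongr
    _ = ∑ p ∈ P, |y-1|^T * |c p| * ∑ i ∈ range (M+1), ((v p).choose i : ℝ) := by
        rw [sum_comm]; simp only [mul_sum]
    _ ≤ ∑ p ∈ P, |y-1|^T * |c p| * 2^M := by
        apply sum_le_sum
        intro p hp
        gcongr
        have : ∑ i ∈ range (M+1), (v p).choose i = 2 ^ v p := by
          rw [← Nat.sum_range_choose]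
          symm
          apply sum_subset
          · intro i; simp; have := hv p hp; omega
          · intro i _ hi
            rw [Nat.choose_eq_zero_of_lt (by simp at hi; omega)]
        have h2 : (∑ i ∈ range (M+1), ((v p).choose i : ℝ)) = 2 ^ v p := by exact_mod_cast this
        rw [h2]
        exact pow_le_pow_right₀ (by norm_num) (hv p hp)
    _ = _ := by rw [mul_sum]; apply sum_congr rfl; intros; ring

open Finset Polynomial in
/-- the difference operator is surjective on polynomials of bounded degree -/
lemma aux_surj (m X0 : ℝ) (hX : X0 ≠ 1) (T : ℕ) (f : ℝ[X]) (hf : f.degree < T) :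
    ∃ q : ℝ[X], q.degree < T ∧ q.comp (X + C m) - C X0 * q = f := by
  let Φ : ℝ[X] →ₗ[ℝ] ℝ[X] :=
    { toFun := fun q => q.comp (X + C m) - C X0 * q
      map_add' := by intro a b; simp only [add_comp]; ring
      map_smul' := by intro a b; simp only [smul_comp, RingHom.id_apply, smul_sub, mul_smul_comm] }
  have hdeg : ∀ q ∈ degreeLT ℝ T, Φ q ∈ degreeLT ℝ T := by
    intro q hq
    rw [mem_degreeLT] at hq ⊢
    refine lt_of_le_of_lt (degree_sub_le _ _) (max_lt ?_ ?_)
    · by_cases h0 : q = 0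
      · simp [h0]
      · have : (q.comp (X + C m)).natDegree = q.natDegree := by simp [natDegree_comp]
        refine lt_of_le_of_lt degree_le_natDegree ?_
        rw [this, ← degree_eq_natDegree h0]; exact hq
    · rw [← smul_eq_C_mul]
      exact lt_of_le_of_lt (degree_smul_le _ _) hq
  let Ψ : degreeLT ℝ T →ₗ[ℝ] degreeLT ℝ T := Φ.restrict hdeg
  have hinj : Function.Injective Ψ := by
    rw [← LinearMap.ker_eq_bot, LinearMap.ker_eq_bot']
    rintro ⟨q, hq⟩ h
    have h1 : q.comp (X + C m) - C X0 * q = 0 := congrArg Subtype.val h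
    have h2 : (q.comp (X + C m)).leadingCoeff = q.leadingCoeff := by
      rw [leadingCoeff_comp (by simp)]; simp
    have h3 : q.leadingCoeff = X0 * q.leadingCoeff := by
      rw [sub_eq_zero.1 h1, leadingCoeff_mul, leadingCoeff_C] at h2
      exact h2.symm
    have h4 : q.leadingCoeff = 0 := by
      have : (1 - X0) * q.leadingCoeff = 0 := by linear_combination h3
      exact (mul_eq_zero.1 this).resolve_left (sub_ne_zero.2 (Ne.symm hX))
    ext1
    exact leadingCoeff_eq_zero.1 h4
  have hsurj := LinearMap.surjective_of_injective hinj
  obtain ⟨⟨q, hq⟩, hqf⟩ := hsurj ⟨f, mem_degreeLT.2 hf⟩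
  exact ⟨q, mem_degreeLT.1 hq, congrArg Subtype.val hqf⟩

open Finset Polynomial in
lemma aux_nonvanish (m s k : ℕ) (hs : s + 1 ≤ m) (c : ℕ × ℕ → ℝ)
    (hc0 : ∀ p ∈ range (s+1) ×ˢ range (k+1), c p ≠ 0)
    (hc : ∀ q : ℝ[X], q.degree < ((s+1)*(k+1) - 1 : ℕ) →
      ∑ p ∈ range (s+1) ×ˢ range (k+1), c p * q.eval ((p.1 + m * p.2 : ℕ) : ℝ) = 0)
    (X0 Y0 : ℝ) (hX : X0 ≠ 1) :
    ∃ i ≤ s, ∑ p ∈ range (s+1) ×ˢ range (k+1),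
      c p * ((p.1 + m * p.2 : ℕ) : ℝ)^i * (X0 ^ p.2 * Y0 ^ p.1) ≠ 0 := by
  by_contra! hcon
  have hvinj : ∀ p ∈ range (s+1) ×ˢ range (k+1), ∀ q ∈ range (s+1) ×ˢ range (k+1),
      p.1 + m * p.2 = q.1 + m * q.2 → p = q := by
    rintro ⟨a, b⟩ h1 ⟨a', b'⟩ h2 h
    simp only [mem_product, mem_range] at h1 h2 h
    have e1 : a = a' := by
      have := congrArg (· % m) h
      simpa [Nat.mod_eq_of_lt (show a < m by omega), Nat.mod_eq_of_lt (show a' < m by omega)] using this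
    subst e1
    have : m * b = m * b' := by omega
    simp [Nat.eq_of_mul_eq_mul_left (by omega) this]
  let A : Matrix (Fin (s+1)) (Fin (s+1)) ℝ := fun i j =>
    ∑ h ∈ range (k+1), c (j, h) * (((j:ℕ) + m * h : ℕ) : ℝ)^(i:ℕ) * X0 ^ h
  have hdet : A.det = 0 := by
    rw [← Matrix.exists_mulVec_eq_zero_iff]
    refine ⟨fun j => Y0 ^ (j:ℕ), ?_, ?_⟩
    · intro h
      have := congrFun h 0
      simp at this
    · ext i
      have h1 := hcon i (by omega)
      rw [sum_product, Finset.sum_range] at h1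
      simp only [Matrix.mulVec, dotProduct, A, Pi.zero_apply]
      rw [← h1]
      apply sum_congr rfl
      intro j _
      rw [sum_mul]
      apply sum_congr rfl
      intros; ring
  obtain ⟨μ, hμ0, hμ⟩ := Matrix.exists_vecMul_eq_zero_iff.2 hdet
  set p : ℝ[X] := ∑ i : Fin (s+1), C (μ i) * X ^ (i:ℕ) with hp
  have hpdeg : p.degree < ((s+1 : ℕ)) := by
    have := degree_sum_fin_lt μ
    simpa [hp] using this
  have hpeval : ∀ x, p.eval x = ∑ i : Fin (s+1), μ i * x ^ (i:ℕ) := by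
    intro x; simp [hp, eval_finsetSum]
  set a : ℕ → ℕ → ℝ := fun j h => p.eval ((j + m * h : ℕ) : ℝ) * c (j, h) with ha
  have hroot : ∀ j < s + 1, ∑ h ∈ range (k+1), a j h * X0 ^ h = 0 := by
    intro j hj
    have h1 := congrFun hμ ⟨j, hj⟩
    simp only [Matrix.vecMul, dotProduct, A, Pi.zero_apply] at h1
    rw [← h1]
    simp only [ha, hpeval, sum_mul, mul_sum]
    rw [sum_comm]
    apply sum_congr rfl; intro i _
    apply sum_congr rfl; intro h _
    ring
  -- quotient coefficients
  have hquot : ∀ j, ∃ g : ℕ → ℝ, j < s + 1 → (∀ w : ℕ → ℝ, ∑ h ∈ range (k+1), a j h * w h =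
      ∑ h ∈ range k, g h * (w (h+1) - X0 * w h)) := by
    intro j
    by_cases hj : j < s + 1
    swap
    · exact ⟨0, fun h => absurd h hj⟩
    refine ⟨fun h => ∑ t ∈ range (k - h), a j (h + 1 + t) * X0 ^ t, fun _ w => ?_⟩
    set g : ℕ → ℝ := fun h => ∑ t ∈ range (k - h), a j (h + 1 + t) * X0 ^ t with hg
    have hrec : ∀ h < k, g h = a j (h+1) + X0 * g (h+1) := by
      intro h hh
      simp only [hg]
      rw [show k - h = (k - (h+1)) + 1 by omega, sum_range_succ', mul_sum, add_comm]
      simp only [pow_zero, mul_one, add_zero]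
      congr 1
      apply sum_congr rfl
      intro t _
      rw [show h + 1 + (t+1) = h + 1 + 1 + t by ring]
      ring
    have hgk : g k = 0 := by simp [hg]
    have h0 : a j 0 = - X0 * g 0 := by
      have := hroot j hj
      rw [sum_range_succ'] at this
      simp only [hg, Nat.sub_zero, mul_sum]
      simp only [pow_zero, mul_one] at this
      rw [← sub_eq_zero, ← this, ← sub_eq_zero]
      have e : ∑ t ∈ range k, a j (t+1) * X0 ^ (t+1) = - ∑ t ∈ range k, -X0 * (a j (0 + 1 + t) * X0 ^ t) := by
        rw [← sum_neg_distrib]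
        apply sum_congr rfl
        intro t _
        rw [show 0 + 1 + t = t + 1 by ring]; ring
      rw [e]; ring
    rw [sum_range_succ', h0]
    have h1 : ∑ h ∈ range k, a j (h+1) * w (h+1) = ∑ h ∈ range k, (g h * w (h+1) - X0 * g (h+1) * w (h+1)) := by
      apply sum_congr rfl
      intro h hh
      rw [hrec h (mem_range.1 hh)]; ring
    have h2 : ∑ h ∈ range k, X0 * g (h+1) * w (h+1) = ∑ h ∈ range k, X0 * g h * w h - X0 * g 0 * w 0 := by
      have := sum_range_succ (fun h => X0 * g h * w h) k
      rw [sum_range_succ', hgk] at this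
      linarith
    rw [h1, sum_sub_distrib, h2]
    have h3 : ∑ h ∈ range k, g h * (w (h+1) - X0 * w h) = ∑ h ∈ range k, g h * w (h+1) - ∑ h ∈ range k, X0 * g h * w h := by
      rw [← sum_sub_distrib]; apply sum_congr rfl; intros; ring
    rw [h3]; ring
  choose g hg using hquot
  set T := (s+1) * k with hT
  set P' := range (s+1) ×ˢ range k with hP'
  have hP'card : #P' = T := by simp [hP', hT]
  have hsub : ∀ x ∈ P', x ∈ range (s+1) ×ˢ range (k+1) := by
    intro x; simp [hP']; omega
  have hmom : ∀ f : ℝ[X], f.degree < T → ∑ x ∈ P', g x.1 x.2 * f.eval ((x.1 + m * x.2 : ℕ) : ℝ) = 0 := by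
    intro f hf
    obtain ⟨q, hq, hqf⟩ := aux_surj m X0 hX T f hf
    have hpq : (p * q).degree < ((s+1)*(k+1) - 1 : ℕ) := by
      by_cases hz : p * q = 0
      · rw [hz, degree_zero]; exact WithBot.bot_lt_coe _
      have hp0 : p ≠ 0 := left_ne_zero_of_mul hz
      have hq0 : q ≠ 0 := right_ne_zero_of_mul hz
      rw [degree_eq_natDegree hz, natDegree_mul hp0 hq0]
      rw [degree_eq_natDegree hp0] at hpdeg
      rw [degree_eq_natDegree hq0] at hq
      have e1 : p.natDegree < s + 1 := by exact_mod_cast hpdeg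
      have e2 : q.natDegree < T := by exact_mod_cast hq
      have : (s+1)*(k+1) = T + (s + 1) := by rw [hT]; ring
      exact_mod_cast (by omega)
    have h1 := hc _ hpq
    rw [sum_product] at h1
    rw [hP', sum_product, ← h1]
    apply sum_congr rfl
    intro j hj
    have h2 := hg j (mem_range.1 hj) (fun h => q.eval ((j + m * h : ℕ) : ℝ))
    have h3 : ∑ h ∈ range (k+1), c (j, h) * (p * q).eval ((j + m * h : ℕ) : ℝ) =
        ∑ h ∈ range (k+1), a j h * q.eval ((j + m * h : ℕ) : ℝ) := by
      apply sum_congr rfl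
      intro h _
      simp only [ha, eval_mul]; ring
    simp only
    rw [h3, h2]
    apply sum_congr rfl
    intro h _
    rw [← hqf]
    simp only [eval_sub, eval_mul, eval_C, eval_comp, eval_add, eval_X]
    congr 4
    push_cast; ring
  have hg0 : ∀ x ∈ P', g x.1 x.2 = 0 := by
    intro x hx
    have hinj : Set.InjOn (fun x : ℕ × ℕ => ((x.1 + m * x.2 : ℕ) : ℝ)) P' := by
      intro x hx y hy hxy
      exact hvinj x (hsub x hx) y (hsub y hy) (Nat.cast_injective (R := ℝ) hxy)
    have h1 := hmom (Lagrange.basis P' (fun x : ℕ × ℕ => ((x.1 + m * x.2 : ℕ) : ℝ)) x) (by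
      rw [Lagrange.degree_basis hinj hx, hP'card]
      have : 0 < T := by rw [← hP'card]; exact card_pos.2 ⟨x, hx⟩
      exact_mod_cast (by omega))
    rw [sum_eq_single_of_mem x hx] at h1
    · have := Lagrange.eval_basis_self hinj hx
      rw [this, mul_one] at h1
      exact h1
    · intro y hy hyx
      have := Lagrange.eval_basis_of_ne (v := (fun x : ℕ × ℕ => ((x.1 + m * x.2 : ℕ) : ℝ))) hyx.symm hy
      rw [this, mul_zero]
  have ha0 : ∀ x ∈ range (s+1) ×ˢ range (k+1), p.eval ((x.1 + m * x.2 : ℕ) : ℝ) = 0 := by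
    rintro ⟨j, h⟩ hx
    rw [mem_product] at hx
    have h1 := hg j (mem_range.1 hx.1) (fun t => if t = h then 1 else 0)
    have h2 : ∑ t ∈ range k, g j t * ((if t + 1 = h then 1 else 0) - X0 * (if t = h then 1 else 0)) = 0 := by
      apply sum_eq_zero
      intro t ht
      have := hg0 (j, t) (by simp only [hP', mem_product]; exact ⟨hx.1, ht⟩)
      rw [this, zero_mul]
    rw [h2] at h1
    simp only [mul_ite, mul_one, mul_zero, sum_ite_eq', hx.2, if_true] at h1
    exact (mul_eq_zero.1 h1).resolve_right (hc0 (j, h) (mem_product.2 hx))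
  have hp0 : p = 0 := by
    apply Polynomial.eq_zero_of_degree_lt_of_eval_index_eq_zero (s := range (s+1))
      (v := fun j : ℕ => (j : ℝ))
    · intro a _ b _ h; exact Nat.cast_injective (R := ℝ) h
    · simpa using hpdeg
    · intro j hj
      have := ha0 (j, 0) (by simp at hj ⊢; omega)
      simpa using this
  apply hμ0
  ext i
  have : p.coeff i = μ i := by
    rw [hp, finsetSum_coeff]
    simp only [coeff_C_mul, coeff_X_pow, mul_ite, mul_one, mul_zero, Fin.val_inj]
    simp
  rw [← this, hp0]; simp

open Finset in
lemma aux_int_zpow {K : Type*} [Field K] (d : K) (a : K)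
    (h1 : IsIntegral ℤ (d * a)) (h2 : IsIntegral ℤ (d * a⁻¹)) (e : ℤ) :
    IsIntegral ℤ (d ^ e.natAbs * a ^ e) := by
  obtain ⟨n, rfl | rfl⟩ := e.eq_nat_or_neg
  · simp only [Int.natAbs_natCast, zpow_natCast]
    rw [← mul_pow]; exact h1.pow n
  · simp only [Int.natAbs_neg, Int.natAbs_natCast, zpow_neg, zpow_natCast]
    rw [← inv_pow, ← mul_pow]; exact h2.pow n

lemma aux_norm_zpow {a B : ℝ} (ha : 0 ≤ a) (h1 : a ≤ B) (h2 : a⁻¹ ≤ B) (e : ℤ) :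
    a ^ e ≤ B ^ e.natAbs := by
  obtain ⟨n, rfl | rfl⟩ := e.eq_nat_or_neg
  · simp only [Int.natAbs_natCast, zpow_natCast]; gcongr
  · simp only [Int.natAbs_neg, Int.natAbs_natCast, zpow_neg, zpow_natCast]
    rw [← inv_pow]; gcongr

open Finset in
lemma aux_liouville_field {K : Type*} [Field K] [NumberField K] {ι : Type*} [Fintype ι] (a : ι → K)
    (σ0 : K →ₐ[ℚ] ℂ) :
    ∃ B : ℝ, 1 ≤ B ∧ ∃ D : ℕ, ∀ (P : Finset (ℕ × ℕ)) (z : ℕ × ℕ → ℤ) (e : ℕ × ℕ → ι → ℤ) (E : ℕ),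
      (∀ p ∈ P, ∑ i, (e p i).natAbs ≤ E) →
      (∑ p ∈ P, (z p : K) * ∏ i, a i ^ e p i) ≠ 0 →
      1 ≤ ‖σ0 (∑ p ∈ P, (z p : K) * ∏ i, a i ^ e p i)‖ * (B ^ E * (∑ p ∈ P, |(z p : ℝ)|) ^ D) := by
  classical
  have : Algebra.IsAlgebraic ℤ K := by
    have : Algebra.IsAlgebraic ℚ K := inferInstance
    exact (IsFractionRing.comap_isAlgebraic_iff (A := ℤ) (K := ℚ) (C := K)).2 this
  obtain ⟨d, hd0, hd⟩ := Algebra.IsAlgebraic.exists_integral_multiples (A := K) ℤ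
    (univ.image a ∪ univ.image (fun i => (a i)⁻¹))
  have hda : ∀ i, IsIntegral ℤ ((d:K) * a i) := fun i => by
    have := hd (a i) (by simp); rwa [zsmul_eq_mul] at this
  have hda' : ∀ i, IsIntegral ℤ ((d:K) * (a i)⁻¹) := fun i => by
    have := hd (a i)⁻¹ (by simp); rwa [zsmul_eq_mul] at this
  have hdi : IsIntegral ℤ (d:K) := by
    have := isIntegral_algebraMap (R := ℤ) (A := K) (x := d); simpa using this
  set B0 : ℝ := 1 + ∑ σ : K →ₐ[ℚ] ℂ, ∑ i, (‖σ (a i)‖ + ‖σ (a i)‖⁻¹) with hB0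
  have hB0le : ∀ (σ : K →ₐ[ℚ] ℂ) i, ‖σ (a i)‖ + ‖σ (a i)‖⁻¹ ≤ B0 := by
    intro σ i
    have h1 : ‖σ (a i)‖ + ‖σ (a i)‖⁻¹ ≤ ∑ i, (‖σ (a i)‖ + ‖σ (a i)‖⁻¹) :=
      single_le_sum (f := fun i => ‖σ (a i)‖ + ‖σ (a i)‖⁻¹) (fun _ _ => by positivity) (mem_univ i)
    have h2 : ∑ i, (‖σ (a i)‖ + ‖σ (a i)‖⁻¹) ≤ ∑ σ : K →ₐ[ℚ] ℂ, ∑ i, (‖σ (a i)‖ + ‖σ (a i)‖⁻¹) :=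
      single_le_sum (f := fun σ : K →ₐ[ℚ] ℂ => ∑ i, (‖σ (a i)‖ + ‖σ (a i)‖⁻¹)) (fun _ _ => by positivity) (mem_univ σ)
    linarith
  have hB01 : 1 ≤ B0 := by
    rw [hB0]
    have : 0 ≤ ∑ σ : K →ₐ[ℚ] ℂ, ∑ i, (‖σ (a i)‖ + ‖σ (a i)‖⁻¹) := by positivity
    linarith
  have hd1 : (1:ℝ) ≤ |(d:ℝ)| := by exact_mod_cast Int.one_le_abs hd0
  set D := Fintype.card (K →ₐ[ℚ] ℂ) with hD
  refine ⟨(|(d:ℝ)| * B0) ^ D, one_le_pow₀ (one_le_mul_of_one_le_of_one_le hd1 hB01), D, ?_⟩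
  intro P z e E hE hne
  set Δ := ∑ p ∈ P, (z p : K) * ∏ i, a i ^ e p i with hΔ
  set W := ∑ p ∈ P, |(z p : ℝ)| with hW
  have hW1 : 1 ≤ W := by
    have hW' : W = ((∑ p ∈ P, |z p| : ℤ) : ℝ) := by rw [hW]; push_cast; rfl
    rw [hW']
    have : (∑ p ∈ P, |z p|) ≠ 0 := by
      intro h0
      rw [sum_eq_zero_iff_of_nonneg (fun _ _ => abs_nonneg _)] at h0
      apply hne
      apply sum_eq_zero
      intro p hp
      rw [abs_eq_zero.1 (h0 p hp)]; simp
    have h2 : 0 ≤ ∑ p ∈ P, |z p| := sum_nonneg (fun _ _ => abs_nonneg _)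
    exact_mod_cast (by omega : 1 ≤ ∑ p ∈ P, |z p|)
  set x := (d:K)^E * Δ with hx
  have hxint : IsIntegral ℤ x := by
    rw [hx, hΔ, mul_sum]
    apply IsIntegral.sum
    intro p hp
    have h1 : (d:K)^E = (d:K)^(E - ∑ i, (e p i).natAbs) * ∏ i, (d:K)^(e p i).natAbs := by
      rw [prod_pow_eq_pow_sum, ← pow_add]
      congr 1
      have := hE p hp
      omega
    have h2 : (d:K)^E * ((z p : K) * ∏ i, a i ^ e p i) =
        (d:K)^(E - ∑ i, (e p i).natAbs) * (z p : K) * ∏ i, ((d:K)^(e p i).natAbs * a i ^ e p i) := by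
      rw [prod_mul_distrib, h1]; ring
    rw [h2]
    refine IsIntegral.mul (IsIntegral.mul (hdi.pow _) ?_) (IsIntegral.prod _ fun i _ => aux_int_zpow _ _ (hda i) (hda' i) _)
    have := isIntegral_algebraMap (R := ℤ) (A := K) (x := z p); simpa using this
  have hx0 : x ≠ 0 := mul_ne_zero (pow_ne_zero _ (by exact_mod_cast hd0)) hne
  have hnorm : 1 ≤ ∏ σ : K →ₐ[ℚ] ℂ, ‖σ x‖ := by
    have h1 := Algebra.isIntegral_norm ℚ hxint
    obtain ⟨y, hy⟩ := (IsIntegrallyClosed.isIntegral_iff (R := ℤ) (K := ℚ)).1 h1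
    have hy0 : y ≠ 0 := by
      rintro rfl
      simp at hy
      exact hx0 (Algebra.norm_eq_zero_iff.1 hy.symm)
    have h2 := Algebra.norm_eq_prod_embeddings ℚ ℂ x
    rw [← norm_prod, ← h2, ← hy]
    simp only [eq_intCast, eq_ratCast, Rat.cast_intCast]
    rw [Complex.norm_intCast]
    exact_mod_cast Int.one_le_abs hy0
  set R := (|(d:ℝ)| * B0)^E * W with hR
  have hσΔ : ∀ σ : K →ₐ[ℚ] ℂ, ‖σ x‖ = |(d:ℝ)|^E * ‖σ Δ‖ := by
    intro σ
    rw [hx, map_mul, map_pow, norm_mul, norm_pow, map_intCast, Complex.norm_intCast]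
  have hbound : ∀ σ : K →ₐ[ℚ] ℂ, ‖σ x‖ ≤ R := by
    intro σ
    rw [hσΔ, hR, mul_pow, mul_assoc]
    gcongr
    rw [hΔ, map_sum, hW, mul_sum]
    refine (norm_sum_le _ _).trans (sum_le_sum fun p hp => ?_)
    rw [map_mul, map_intCast, norm_mul, Complex.norm_intCast, mul_comm, map_prod, norm_prod]
    gcongr
    calc ∏ i, ‖σ (a i ^ e p i)‖ ≤ ∏ i, B0 ^ (e p i).natAbs := by
          apply prod_le_prod
          · intros; positivity
          · intro i _
            rw [map_zpow₀, norm_zpow]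
            have h0 := hB0le σ i
            have h1 : 0 ≤ ‖σ (a i)‖ := norm_nonneg _
            have h2 : 0 ≤ ‖σ (a i)‖⁻¹ := by positivity
            exact aux_norm_zpow h1 (by linarith) (by linarith) _
      _ = B0 ^ (∑ i, (e p i).natAbs) := prod_pow_eq_pow_sum _ _ _
      _ ≤ B0 ^ E := pow_le_pow_right₀ hB01 (hE p hp)
  have hdB : 1 ≤ |(d:ℝ)| * B0 := one_le_mul_of_one_le_of_one_le hd1 hB01
  have hR0 : 0 ≤ R := by positivity
  have hfin : ∏ σ : K →ₐ[ℚ] ℂ, ‖σ x‖ ≤ ‖σ0 Δ‖ * R ^ D := by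
    rw [← mul_prod_erase _ _ (mem_univ σ0)]
    have h1 : ∏ σ ∈ univ.erase σ0, ‖σ x‖ ≤ R ^ (D - 1) := by
      calc _ ≤ ∏ σ ∈ univ.erase σ0, R := prod_le_prod (fun _ _ => norm_nonneg _) (fun σ _ => hbound σ)
        _ = _ := by rw [prod_const, card_erase_of_mem (mem_univ _), card_univ]
    have h2 : |(d:ℝ)|^E ≤ R := by
      rw [hR, mul_pow, mul_assoc]
      apply le_mul_of_one_le_right (by positivity)
      exact one_le_mul_of_one_le_of_one_le (one_le_pow₀ hB01) hW1
    have hDpos : D = (D - 1) + 1 := by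
      have : 0 < D := Fintype.card_pos_iff.2 ⟨σ0⟩
      omega
    rw [hσΔ]
    calc |(d:ℝ)|^E * ‖σ0 Δ‖ * ∏ σ ∈ univ.erase σ0, ‖σ x‖ ≤ R * ‖σ0 Δ‖ * R ^ (D-1) := by gcongr
      _ = ‖σ0 Δ‖ * R ^ D := by rw [show R ^ D = R ^ (D-1) * R by rw [← pow_succ, ← hDpos]]; ring
  have hRD : R ^ D = ((|(d:ℝ)| * B0) ^ D) ^ E * W ^ D := by
    rw [hR, mul_pow, ← pow_mul, ← pow_mul, mul_comm E D]
  rw [← hRD]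
  exact hnorm.trans hfin

open Finset in
lemma aux_liouville {ι : Type*} [Fintype ι] (α : ι → ℝ) (hα : ∀ i, IsAlgebraic ℚ (α i)) :
    ∃ B : ℝ, 1 ≤ B ∧ ∃ D : ℕ, ∀ (P : Finset (ℕ × ℕ)) (z : ℕ × ℕ → ℤ) (e : ℕ × ℕ → ι → ℤ) (E : ℕ),
      (∀ p ∈ P, ∑ i, (e p i).natAbs ≤ E) →
      (∑ p ∈ P, (z p : ℝ) * ∏ i, α i ^ e p i) ≠ 0 →
      1 ≤ |∑ p ∈ P, (z p : ℝ) * ∏ i, α i ^ e p i| * (B ^ E * (∑ p ∈ P, |(z p : ℝ)|) ^ D) := by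
  classical
  let K := IntermediateField.adjoin ℚ (Set.range α)
  have : FiniteDimensional ℚ K := IntermediateField.finiteDimensional_adjoin (by
    rintro _ ⟨i, rfl⟩
    exact (hα i).isIntegral)
  have : NumberField K := { to_charZero := inferInstance, to_finiteDimensional := inferInstance }
  let a : ι → K := fun i => ⟨α i, IntermediateField.subset_adjoin _ _ ⟨i, rfl⟩⟩
  let σ0 : K →ₐ[ℚ] ℂ := (Complex.ofRealAm.restrictScalars ℚ).comp K.val
  obtain ⟨B, hB, D, h⟩ := aux_liouville_field a σ0
  refine ⟨B, hB, D, fun P z e E hE hne => ?_⟩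
  have hval : (K.val (∑ p ∈ P, (z p : K) * ∏ i, a i ^ e p i)) = ∑ p ∈ P, (z p : ℝ) * ∏ i, α i ^ e p i := by
    simp only [map_sum, map_mul, map_intCast, map_prod, map_zpow₀]
    rfl
  have h1 := h P z e E hE (by
    intro h0
    rw [h0, map_zero] at hval
    exact hne hval.symm)
  have h2 : σ0 (∑ p ∈ P, (z p : K) * ∏ i, a i ^ e p i) =
      ((∑ p ∈ P, (z p : ℝ) * ∏ i, α i ^ e p i : ℝ) : ℂ) := by
    rw [← hval]; rfl
  rw [h2, Complex.norm_real, Real.norm_eq_abs] at h1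
  exact h1

open Finset Polynomial in
lemma aux_pair {ι : Type*} [Fintype ι] (α : ι → ℝ) (hpos : ∀ i, 0 < α i) (B : ℝ) (hB : 1 ≤ B) (D : ℕ)
    (hL : ∀ (P : Finset (ℕ × ℕ)) (z : ℕ × ℕ → ℤ) (e : ℕ × ℕ → ι → ℤ) (E : ℕ),
      (∀ p ∈ P, ∑ i, (e p i).natAbs ≤ E) →
      (∑ p ∈ P, (z p : ℝ) * ∏ i, α i ^ e p i) ≠ 0 →
      1 ≤ |∑ p ∈ P, (z p : ℝ) * ∏ i, α i ^ e p i| * (B ^ E * (∑ p ∈ P, |(z p : ℝ)|) ^ D))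
    (e s : ℕ) (he : 1 ≤ e) (hs : s + 1 ≤ 2^e) :
    ∃ A : ℝ, 1 ≤ A ∧ ∀ (k : ℕ) (b₁ b₂ c₀ : ι → ℤ), (∀ i, b₂ i = b₁ i + 2^e * c₀ i) →
      (∑ i, b₁ i * Real.log (α i)) ≠ 0 → |∑ i, b₁ i * Real.log (α i)| ≤ 1 →
      |∑ i, b₂ i * Real.log (α i)| ≤ 1 →
      1 ≤ (|∑ i, b₁ i * Real.log (α i)| ^ ((s+1)*k) + |∑ i, b₂ i * Real.log (α i)|) * A ^ (k+1) *
        B ^ (k * ∑ i, (b₁ i).natAbs + s * ∑ i, (c₀ i).natAbs) := by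
  obtain ⟨c, hc1, hw⟩ := aux_weights e s he hs
  set m : ℕ := 2^e with hm
  have hm2 : 2 ≤ m := by rw [hm]; calc 2 = 2^1 := rfl
                            _ ≤ 2^e := Nat.pow_le_pow_right (by norm_num) he
  set w : ℝ := 2^(s+1) * c * (2^m)^s with hwdef
  have hw1 : 1 ≤ w := by
    apply one_le_mul_of_one_le_of_one_le
    · exact one_le_mul_of_one_le_of_one_le (one_le_pow₀ (by norm_num)) hc1
    · exact one_le_pow₀ (one_le_pow₀ (by norm_num))
  have hexp1 : 1 ≤ Real.exp 1 := Real.one_le_exp zero_le_one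
  set A0 : ℝ := 2^m * (2 * Real.exp 1) with hA0
  have hA1 : (2:ℝ)^m ≤ A0 := le_mul_of_one_le_right (by positivity) (by linarith)
  have hA2 : 2 * Real.exp 1 ≤ A0 := le_mul_of_one_le_left (by positivity) (one_le_pow₀ (by norm_num))
  have hA01 : 1 ≤ A0 := by linarith
  refine ⟨A0 * w^(D+1), one_le_mul_of_one_le_of_one_le hA01 (one_le_pow₀ hw1), ?_⟩
  intro k b₁ b₂ c₀ hb h10 h11 h21
  set L₁ := ∑ i, b₁ i * Real.log (α i) with hL₁
  set L₂ := ∑ i, b₂ i * Real.log (α i) with hL₂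
  obtain ⟨C, hC0, hCb, hCm⟩ := hw k
  set P := range (s+1) ×ˢ range (k+1) with hP
  set v : ℕ × ℕ → ℕ := fun p => p.1 + m * p.2 with hv
  have hm0 : (0:ℝ) < m := by exact_mod_cast (by omega)
  set X0 := Real.exp (-L₁) with hX0
  set Y0 := Real.exp ((L₂ - L₁)/m) with hY0
  set y0 := Real.exp (-L₁/m) with hy0
  have hX01 : X0 ≠ 1 := by
    rw [hX0, Ne, Real.exp_eq_one_iff]; simpa using h10
  obtain ⟨i, his, hΔ0⟩ := aux_nonvanish m s k hs (fun p => (C p : ℝ))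
    (fun p hp => by exact_mod_cast hC0 p hp) hCm X0 Y0 hX01
  set z : ℕ × ℕ → ℤ := fun p => C p * (v p : ℤ)^i with hz
  set ex : ℕ × ℕ → ι → ℤ := fun p t => - (p.2 : ℤ) * b₁ t + p.1 * c₀ t with hex
  have hc₀ : ∑ t, (c₀ t : ℝ) * Real.log (α t) = (L₂ - L₁)/m := by
    rw [eq_div_iff hm0.ne', hL₁, hL₂, ← sum_sub_distrib, sum_mul]
    apply sum_congr rfl
    intro t _
    have h1 : (b₂ t : ℝ) = b₁ t + m * c₀ t := by
      rw [hb t, hm]; push_cast; ring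
    rw [h1]; ring
  have hmon : ∀ p, ∏ t, α t ^ ex p t = X0 ^ p.2 * Y0 ^ p.1 := by
    intro p
    have h1 : ∀ t, α t ^ ex p t = Real.exp (ex p t * Real.log (α t)) := by
      intro t
      rw [mul_comm, Real.exp_mul, Real.exp_log (hpos t), Real.rpow_intCast]
    simp only [h1]
    rw [← Real.exp_sum, hX0, hY0, ← Real.exp_nat_mul, ← Real.exp_nat_mul, ← Real.exp_add, ← hc₀, hL₁]
    congr 1
    rw [← sum_neg_distrib, mul_sum, mul_sum, ← sum_add_distrib]
    apply sum_congr rfl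
    intro t _
    simp only [hex]
    push_cast
    ring
  have hDelta : ∑ p ∈ P, (z p : ℝ) * ∏ t, α t ^ ex p t =
      ∑ p ∈ P, (C p : ℝ) * ((p.1 + m * p.2 : ℕ) : ℝ)^i * (X0 ^ p.2 * Y0 ^ p.1) := by
    apply sum_congr rfl
    intro p _
    rw [hmon]
    simp only [hz, hv]
    push_cast
    rfl
  set E := k * ∑ i, (b₁ i).natAbs + s * ∑ i, (c₀ i).natAbs with hE
  have hLio := hL P z ex E (by
    intro p hp
    rw [hP, mem_product, mem_range, mem_range] at hp
    calc ∑ t, (ex p t).natAbs ≤ ∑ t, (k * (b₁ t).natAbs + s * (c₀ t).natAbs) := by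
          apply sum_le_sum
          intro t _
          simp only [hex]
          refine (Int.natAbs_add_le _ _).trans ?_
          rw [Int.natAbs_mul, Int.natAbs_mul, Int.natAbs_neg, Int.natAbs_natCast, Int.natAbs_natCast]
          gcongr <;> omega
      _ = E := by rw [sum_add_distrib, ← mul_sum, ← mul_sum]) (by rw [hDelta]; exact hΔ0)
  set Δ := ∑ p ∈ P, (z p : ℝ) * ∏ t, α t ^ ex p t with hΔ
  set W := ∑ p ∈ P, |(z p : ℝ)| with hW
  set M := m * (k+1) with hM
  have hvM : ∀ p ∈ P, v p ≤ M := by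
    intro p hp
    rw [hP, mem_product, mem_range, mem_range] at hp
    have : m * p.2 ≤ m * k := Nat.mul_le_mul_left _ (by omega)
    simp only [hv, hM]
    rw [mul_add]
    omega
  have hWle : W ≤ w^(k+1) := by
    have hM2 : (M:ℝ) ≤ (2^m)^(k+1) := by
      rw [← pow_mul]; exact_mod_cast (Nat.lt_two_pow_self).le
    have hcard : ((s+1)*(k+1) : ℝ) ≤ (2^(s+1))^(k+1) := by
      rw [← pow_mul]; exact_mod_cast (Nat.lt_two_pow_self).le
    calc W ≤ ∑ p ∈ P, c^(k+1) * ((2^m)^(k+1))^s := by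
          apply sum_le_sum
          intro p hp
          simp only [hz]
          push_cast
          rw [abs_mul, abs_pow, Nat.abs_cast]
          have h1 : (v p : ℝ) ≤ (2^m)^(k+1) := le_trans (by exact_mod_cast hvM p hp) hM2
          have h2 : (1:ℝ) ≤ (2^m)^(k+1) := one_le_pow₀ (one_le_pow₀ (by norm_num))
          have h3 : (v p : ℝ)^i ≤ ((2^m)^(k+1))^s :=
            (pow_le_pow_left₀ (by positivity) h1 i).trans (pow_le_pow_right₀ h2 his)
          have h4 := hCb p hp
          gcongr
      _ = ((s+1)*(k+1)) * (c^(k+1) * ((2^m)^(k+1))^s) := by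
          rw [sum_const, nsmul_eq_mul]; simp [hP]
      _ ≤ (2^(s+1))^(k+1) * (c^(k+1) * ((2^m)^(k+1))^s) := by gcongr
      _ = w^(k+1) := by rw [hwdef]; ring
  have hW0 : 0 ≤ W := sum_nonneg (fun _ _ => abs_nonneg _)
  have hQ : |∑ p ∈ P, (z p : ℝ) * y0 ^ v p| ≤ |L₁|^((s+1)*k) * (2^M * W) := by
    have hy1 : |y0 - 1| ≤ |L₁| := by
      have h1 : |-L₁/m| ≤ |L₁|/2 := by
        rw [abs_div, abs_neg, Nat.abs_cast]
        gcongr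
        exact_mod_cast hm2
      have := Real.abs_exp_sub_one_le (x := -L₁/m) (by linarith [abs_nonneg L₁])
      rw [hy0]; linarith
    have h2 := aux_small P v (fun p => (z p : ℝ)) ((s+1)*k) M hvM (by
      intro q hq
      have h3 := hCm (X^i * q) (by
        by_cases hq0 : q = 0
        · rw [hq0, mul_zero, degree_zero]; exact WithBot.bot_lt_coe _
        rw [degree_mul, degree_X_pow, degree_eq_natDegree hq0]
        rw [degree_eq_natDegree hq0] at hq
        have h4 : q.natDegree < (s+1)*k := by exact_mod_cast hq
        have h5 : (s+1)*(k+1) = (s+1)*k + (s+1) := by ring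
        exact_mod_cast (by omega))
      rw [← h3]
      apply sum_congr rfl
      intro p _
      simp only [hz, eval_mul, eval_pow, eval_X, hv]
      push_cast
      ring) y0 (hy1.trans h11)
    refine h2.trans ?_
    rw [mul_assoc]
    gcongr
  have hdiff : |Δ - ∑ p ∈ P, (z p : ℝ) * y0 ^ v p| ≤ |L₂| * ((2 * Real.exp 1)^(k+1) * W) := by
    rw [hΔ, ← sum_sub_distrib]
    refine (abs_sum_le_sum_abs _ _).trans ?_
    rw [hW, mul_sum, mul_sum]
    apply sum_le_sum
    intro p hp
    rw [← mul_sub, abs_mul, hmon]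
    have hpm := hp
    rw [hP, mem_product, mem_range, mem_range] at hpm
    have h1 : X0 ^ p.2 * Y0 ^ p.1 = y0 ^ v p * Real.exp (p.1 * L₂ / m) := by
      rw [hX0, hY0, hy0, ← Real.exp_nat_mul, ← Real.exp_nat_mul, ← Real.exp_nat_mul, ← Real.exp_add, ← Real.exp_add]
      congr 1
      simp only [hv]
      push_cast
      field_simp
      ring
    have h2 : y0 ^ v p ≤ (Real.exp 1)^(k+1) := by
      rw [hy0, ← Real.exp_nat_mul, ← Real.exp_nat_mul]
      apply Real.exp_le_exp.2
      have a1 : (v p : ℝ) ≤ m * (k+1) := by exact_mod_cast hvM p hp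
      have a2 : -L₁ ≤ 1 := by linarith [neg_abs_le L₁]
      have a3 : (0:ℝ) ≤ v p := by positivity
      rw [← mul_div_assoc, div_le_iff₀ hm0]
      push_cast
      nlinarith
    have h3 : |p.1 * L₂ / m| ≤ |L₂| := by
      rw [abs_div, abs_mul, Nat.abs_cast, Nat.abs_cast, div_le_iff₀ hm0, mul_comm]
      have : (p.1 : ℝ) ≤ m := by exact_mod_cast (by omega)
      gcongr
    have h4 := Real.abs_exp_sub_one_le (h3.trans h21)
    have h5 : |X0 ^ p.2 * Y0 ^ p.1 - y0 ^ v p| ≤ (Real.exp 1)^(k+1) * (2 * |L₂|) := by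
      rw [h1, show y0 ^ v p * Real.exp (p.1 * L₂ / m) - y0 ^ v p = y0 ^ v p * (Real.exp (p.1 * L₂ / m) - 1) by ring,
        abs_mul, abs_of_nonneg (by positivity)]
      gcongr
      linarith
    calc |(z p : ℝ)| * |X0 ^ p.2 * Y0 ^ p.1 - y0 ^ v p| ≤ |(z p : ℝ)| * ((Real.exp 1)^(k+1) * (2 * |L₂|)) := by gcongr
      _ = |L₂| * ((2 * Real.exp 1 ^(k+1)) * |(z p : ℝ)|) := by ring
      _ ≤ |L₂| * ((2 * Real.exp 1)^(k+1) * |(z p : ℝ)|) := by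
          rw [mul_pow]
          gcongr
          calc (2:ℝ) = 2^1 := by norm_num
            _ ≤ 2^(k+1) := pow_le_pow_right₀ (by norm_num) (by omega)
  have hΔle : |Δ| ≤ (|L₁|^((s+1)*k) + |L₂|) * (A0^(k+1) * W) := by
    have h1 : |Δ| ≤ |Δ - ∑ p ∈ P, (z p : ℝ) * y0 ^ v p| + |∑ p ∈ P, (z p : ℝ) * y0 ^ v p| := by
      have := abs_add_le (Δ - ∑ p ∈ P, (z p : ℝ) * y0 ^ v p) (∑ p ∈ P, (z p : ℝ) * y0 ^ v p)
      simpa using this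
    have h2 : |L₁|^((s+1)*k) * (2^M * W) ≤ |L₁|^((s+1)*k) * (A0^(k+1) * W) := by
      have h4 : (2:ℝ)^M = (2^m)^(k+1) := by rw [hM, pow_mul]
      rw [h4]; gcongr
    have h3 : |L₂| * ((2 * Real.exp 1)^(k+1) * W) ≤ |L₂| * (A0^(k+1) * W) := by gcongr
    rw [add_mul]; linarith
  have hS0 : 0 ≤ |L₁|^((s+1)*k) + |L₂| := by positivity
  have hA0' : 0 ≤ A0 := by linarith
  calc (1:ℝ) ≤ |Δ| * (B^E * W^D) := hLio
    _ ≤ (|L₁|^((s+1)*k) + |L₂|) * (A0^(k+1) * W) * (B^E * W^D) := by gcongr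
    _ = (|L₁|^((s+1)*k) + |L₂|) * (A0^(k+1) * W^(D+1)) * B^E := by ring
    _ ≤ (|L₁|^((s+1)*k) + |L₂|) * (A0^(k+1) * (w^(k+1))^(D+1)) * B^E := by gcongr
    _ = _ := by rw [mul_pow A0, ← pow_mul, ← pow_mul, mul_comm (k+1) (D+1)]

open Finset in
lemma aux_ball {ι : Type*} [Fintype ι] (N : ℕ) : {b : ι → ℤ | ∑ i, (b i).natAbs ≤ N}.Finite := by
  classical
  apply (Set.finite_Icc (fun _ : ι => -(N:ℤ)) (fun _ => (N:ℤ))).subset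
  intro b hb
  have h : ∀ i, (b i).natAbs ≤ N := fun i =>
    (single_le_sum (f := fun i => (b i).natAbs) (fun _ _ => Nat.zero_le _) (mem_univ i)).trans hb
  constructor <;> intro i <;> have := h i <;> simp only <;> omega

open Finset in
theorem aux_main {ι : Type*} [Fintype ι] (α : ι → ℝ) (hpos : ∀ i, 0 < α i)
    (halg : ∀ i, IsAlgebraic ℚ (α i)) (ε : ℝ) (hε : 0 < ε) :
    {b : ι → ℤ | (∑ i, b i * Real.log (α i)) ≠ 0 ∧
      |∑ i, b i * Real.log (α i)| ≤ Real.exp (-ε * (∑ i, (b i).natAbs : ℕ))}.Finite := by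
  classical
  obtain ⟨B, hB, D, hL⟩ := aux_liouville α halg
  set lB := Real.log B with hlB
  have hlB0 : 0 ≤ lB := Real.log_nonneg hB
  obtain ⟨s, hs⟩ := exists_nat_ge (8 * lB / ε)
  have hs' : lB * 8 ≤ ε * (s + 1) := by
    rw [div_le_iff₀ hε] at hs; nlinarith
  obtain ⟨e0, he0⟩ := exists_nat_ge (8 * lB * s / ε)
  set e := e0 + s + 1 with he
  have h2e : e < 2^e := Nat.lt_two_pow_self
  have hes : s + 1 ≤ 2^e := by omega
  have hm : 8 * (lB * s) ≤ ε * (2:ℝ)^e := by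
    rw [div_le_iff₀ hε] at he0
    have : (e0:ℝ) ≤ 2^e := by exact_mod_cast (by omega)
    nlinarith
  obtain ⟨A, hA, hpair⟩ := aux_pair α hpos B hB D hL e s (by omega) hes
  set lA := Real.log A with hlA
  have hlA0 : 0 ≤ lA := Real.log_nonneg hA
  set S := {b : ι → ℤ | (∑ i, b i * Real.log (α i)) ≠ 0 ∧
      |∑ i, b i * Real.log (α i)| ≤ Real.exp (-ε * (∑ i, (b i).natAbs : ℕ))} with hS
  let m : ℕ := 2^e
  have : NeZero m := ⟨by positivity⟩
  have hun : S = ⋃ r : ι → ZMod m, {b ∈ S | (fun i => (b i : ZMod m)) = r} := by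
    ext b; simp
  rw [hun]
  apply Set.finite_iUnion
  intro r
  by_contra hinf
  have hlarge : ∀ N : ℕ, ∃ b ∈ {b ∈ S | (fun i => (b i : ZMod m)) = r}, N < ∑ i, (b i).natAbs := by
    intro N
    by_contra! hcon
    exact hinf ((aux_ball N).subset hcon)
  obtain ⟨N1, hN1⟩ := exists_nat_ge (8 * lA / ε)
  obtain ⟨b₁, ⟨⟨h10, h11⟩, h1r⟩, hb₁⟩ := hlarge N1
  set n1 := ∑ i, (b₁ i).natAbs with hn1
  obtain ⟨N2, hN2⟩ := exists_nat_ge (8 * (1 + 2 * lA + n1 * lB + n1 * ε) / ε)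
  obtain ⟨b₂, ⟨⟨h20, h21⟩, h2r⟩, hb₂⟩ := hlarge N2
  set n2 := ∑ i, (b₂ i).natAbs with hn2
  have hcong : ∀ i, ∃ c : ℤ, b₂ i = b₁ i + 2^e * c := by
    intro i
    have h1 : ((b₁ i : ℤ) : ZMod m) = (b₂ i : ℤ) := by
      rw [congrFun h1r i, congrFun h2r i]
    rw [ZMod.intCast_eq_intCast_iff_dvd_sub] at h1
    obtain ⟨c, hc⟩ := h1
    refine ⟨c, ?_⟩
    have : (m:ℤ) = 2^e := by simp [m]
    rw [this] at hc
    omega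
  choose c₀ hc₀ using hcong
  have hle1 : ∀ n : ℕ, Real.exp (-ε * n) ≤ 1 := by
    intro n
    rw [Real.exp_le_one_iff]
    have : 0 ≤ ε * n := by positivity
    linarith
  set k := n2 / ((s+1)*n1) + 1 with hk
  have hn1pos : 0 < n1 := by omega
  have hkl : n2 ≤ (s+1)*n1*k := by
    have := Nat.lt_div_mul_add (a := n2) (b := (s+1)*n1) (by positivity)
    rw [hk, mul_add, mul_one, mul_comm]; omega
  have hku : (s+1)*n1*k ≤ n2 + (s+1)*n1 := by
    have := Nat.mul_div_le n2 ((s+1)*n1)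
    rw [hk, mul_add, mul_one]; omega
  have hp := hpair k b₁ b₂ c₀ hc₀ h10 (h11.trans (hle1 _)) (h21.trans (hle1 _))
  set nc := ∑ i, (c₀ i).natAbs with hnc
  have hncle : 2^e * nc ≤ n1 + n2 := by
    rw [hnc, mul_sum, hn1, hn2, ← sum_add_distrib]
    apply sum_le_sum
    intro i _
    have h1 : (2^e * c₀ i) = b₂ i - b₁ i := by rw [hc₀ i]; ring
    have h2 : (2^e * (c₀ i).natAbs) = (b₂ i - b₁ i).natAbs := by
      rw [← h1, Int.natAbs_mul, Int.natAbs_pow]; rfl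
    rw [h2]; omega
  have hsmall : |∑ i, b₁ i * Real.log (α i)| ^ ((s+1)*k) ≤ Real.exp (-ε * n2) := by
    calc _ ≤ (Real.exp (-ε * n1))^((s+1)*k) := by gcongr
      _ = Real.exp (((s+1)*k : ℕ) * (-ε * n1)) := (Real.exp_nat_mul _ _).symm
      _ ≤ _ := by
        apply Real.exp_le_exp.2
        have : (n2:ℝ) ≤ (s+1)*n1*k := by exact_mod_cast hkl
        push_cast
        nlinarith
  have hfin : 1 ≤ 2 * Real.exp (-ε * n2) * A^(k+1) * B^(k * n1 + s * nc) := by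
    refine hp.trans ?_
    gcongr
    linarith
  have hlog := Real.log_le_log one_pos hfin
  have hA0 : (0:ℝ) < A := by linarith
  have hB0 : (0:ℝ) < B := by linarith
  rw [Real.log_one, Real.log_mul (by positivity) (by positivity), Real.log_mul (by positivity) (by positivity),
    Real.log_mul (by positivity) (by positivity), Real.log_exp, Real.log_pow, Real.log_pow, ← hlA, ← hlB] at hlog
  push_cast at hlog
  have hlog2 : Real.log 2 ≤ 1 := by linarith [Real.log_two_lt_d9]
  have r1 : (n1:ℝ) > N1 := by exact_mod_cast hb₁
  have r2 : (n2:ℝ) > N2 := by exact_mod_cast hb₂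
  have r3 : ((s:ℝ)+1)*n1*k ≤ n2 + (s+1)*n1 := by exact_mod_cast hku
  have r4 : (2:ℝ)^e * nc ≤ n1 + n2 := by exact_mod_cast hncle
  rw [div_le_iff₀ hε] at hN1 hN2
  have r5 : 8 * lA ≤ n1 * ε := by linarith [mul_lt_mul_of_pos_right r1 hε]
  have r6 : 8 * (1 + 2 * lA + n1 * lB + n1 * ε) < n2 * ε := by linarith [mul_lt_mul_of_pos_right r2 hε]
  have hn1R : (1:ℝ) ≤ n1 := by exact_mod_cast hn1pos
  have hsR : (0:ℝ) ≤ s := by positivity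
  have hs1 : (0:ℝ) < s + 1 := by positivity
  have hkR : (0:ℝ) ≤ k := by positivity
  have hncR : (0:ℝ) ≤ nc := by positivity
  have hn2R : (0:ℝ) ≤ n2 := by positivity
  -- k * lA
  have t0 : (k:ℝ) * n1 ≤ n2 / (s+1) + n1 := by
    rw [← sub_nonneg, show (n2:ℝ) / (s+1) + n1 - k * n1 = (n2 + (s+1)*n1 - (s+1)*n1*k)/(s+1) by field_simp]
    apply div_nonneg <;> linarith
  have t1 : 8 * ((k:ℝ) * n1 * lB) ≤ ε * n2 + 8 * (n1 * lB) := by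
    have a1 : (k:ℝ) * n1 * lB ≤ (n2 / (s+1) + n1) * lB := by gcongr
    have a2 : (n2:ℝ) / (s+1) * (lB * 8) ≤ n2 / (s+1) * (ε * (s+1)) := by gcongr
    have a3 : (n2:ℝ) / (s+1) * (ε * (s+1)) = ε * n2 := by field_simp
    linarith
  have t2 : 8 * ((k:ℝ) * lA) ≤ ε * n2 + 8 * lA := by
    have a1 : (k:ℝ) * n1 ≤ n2 + n1 := by
      have : (n2:ℝ) / (s+1) ≤ n2 := div_le_self hn2R (by linarith)
      linarith
    have a2 : ((k:ℝ) - 1) * n1 ≤ n2 := by linarith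
    have hk0 : 1 ≤ k := by rw [hk]; exact Nat.le_add_left _ _
    have hk1 : (1:ℝ) ≤ k := by exact_mod_cast hk0
    have a3 : ((k:ℝ) - 1) * (8 * lA) ≤ (k - 1) * (n1 * ε) := by
      apply mul_le_mul_of_nonneg_left r5; linarith
    have a4 : ((k:ℝ) - 1) * n1 * ε ≤ n2 * ε := mul_le_mul_of_nonneg_right a2 hε.le
    linarith
  have t3 : 8 * ((s:ℝ) * nc * lB) ≤ ε * (n1 + n2) := by
    calc 8 * ((s:ℝ) * nc * lB) = (8 * (lB * s)) * nc := by ring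
      _ ≤ (ε * 2^e) * nc := by gcongr
      _ = ε * (2^e * nc) := by ring
      _ ≤ _ := by gcongr
  have t4 : 0 < (n2:ℝ) * ε := by linarith [mul_nonneg (zero_le_one.trans hn1R) hlB0, mul_nonneg (zero_le_one.trans hn1R) hε.le]
  linarith

lemma aux_alg_norm (q : ℍ[ℝ]) (h : AlgQuat q) : IsAlgebraic ℚ ‖q‖ := by
  obtain ⟨h1, h2, h3, h4⟩ := h
  have h5 : IsAlgebraic ℚ (‖q‖ ^ 2) := by
    rw [pow_two, ← Quaternion.normSq_eq_norm_mul_self, Quaternion.normSq_def']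
    exact (((h1.pow 2).add (h2.pow 2)).add (h3.pow 2)).add (h4.pow 2)
  exact h5.of_pow (by norm_num)

lemma aux_list (S : Finset ℍ[ℝ]) (f : ℍ[ℝ]) (hf : f ∈ Subsemigroup.closure (S : Set ℍ[ℝ])) :
    ∃ l : List S, (l.map Subtype.val).prod = f := by
  induction hf using Subsemigroup.closure_induction with
  | mem x hx => exact ⟨[⟨x, hx⟩], by simp⟩
  | mul x y _ _ hx hy =>
    obtain ⟨l, rfl⟩ := hx
    obtain ⟨l', rfl⟩ := hy
    exact ⟨l ++ l', by simp⟩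

lemma aux_count {β : Type*} [Fintype β] [BEq β] [LawfulBEq β] (l : List β) (F : β → ℝ) :
    ∑ x, (l.count x : ℝ) * F x = (l.map F).sum := by
  classical
  induction l with
  | nil => simp
  | cons y l ih =>
    simp only [List.count_cons, List.map_cons, List.sum_cons, ← ih]
    push_cast
    simp only [add_mul, Finset.sum_add_distrib]
    rw [add_comm]
    congr 1
    simp

lemma aux_count_len {β : Type*} [Fintype β] [BEq β] [LawfulBEq β] (l : List β) :
    ∑ x, l.count x = l.length := by
  have := aux_count l (fun _ => 1)
  simp at this
  exact_mod_cast this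

lemma aux_log_norm (S : Finset ℍ[ℝ]) (hS : ∀ g ∈ S, 1 < ‖g‖) (l : List S) :
    Real.log ‖(l.map Subtype.val).prod‖ = (l.map (fun x => Real.log ‖x.1‖)).sum ∧
      (l.map Subtype.val).prod ≠ 0 := by
  induction l with
  | nil => simp
  | cons y l ih =>
    have hy : y.1 ≠ 0 := by
      intro h
      have := hS y.1 y.2
      rw [h, norm_zero] at this
      linarith
    refine ⟨?_, ?_⟩
    · simp only [List.map_cons, List.prod_cons, List.sum_cons, norm_mul]
      rw [Real.log_mul (norm_ne_zero_iff.2 hy) (norm_ne_zero_iff.2 ih.2), ih.1]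
    · simp only [List.map_cons, List.prod_cons]
      exact mul_ne_zero hy ih.2

lemma aux_min (S : Finset ℍ[ℝ]) (hS : ∀ g ∈ S, 1 < ‖g‖) :
    ∃ δ : ℝ, 0 < δ ∧ ∀ g ∈ S, δ ≤ Real.log ‖g‖ := by
  by_cases h : S.Nonempty
  · obtain ⟨g, hg, hmin⟩ := S.exists_min_image (fun g => Real.log ‖g‖) h
    exact ⟨Real.log ‖g‖, Real.log_pos (hS g hg), hmin⟩
  · refine ⟨1, one_pos, fun g hg => absurd ⟨g, hg⟩ h⟩

lemma aux_len_le (S : Finset ℍ[ℝ]) (δ : ℝ) (h : ∀ g ∈ S, δ ≤ Real.log ‖g‖) (l : List S) :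
    δ * l.length ≤ (l.map (fun x => Real.log ‖x.1‖)).sum := by
  induction l with
  | nil => simp
  | cons y l ih =>
    simp only [List.map_cons, List.sum_cons, List.length_cons]
    push_cast
    linarith [h y.1 y.2]

lemma aux_half (γ δ lu lv : ℝ) (n1 n2 : ℕ) (hγ : 0 ≤ γ) (hδ : 0 < δ) (h1 : -γ + δ * n1 ≤ lu)
    (h2 : -γ + δ * n2 ≤ lv) (h : |Real.exp lu - Real.exp lv| ≤ 1) :
    lu - lv ≤ Real.exp (Real.log 2 + 2 * γ - δ / 2 * (n1 + n2)) := by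
  obtain ⟨ha, hb⟩ := abs_le.1 h
  have e1 : lu - lv ≤ Real.exp (-lv) := by
    have h3 := Real.add_one_le_exp (lu - lv)
    have h4 : Real.exp (lu - lv) - 1 = (Real.exp lu - Real.exp lv) * Real.exp (-lv) := by
      rw [sub_mul, ← Real.exp_add, ← Real.exp_add]; simp [sub_eq_add_neg]
    have h5 : (Real.exp lu - Real.exp lv) * Real.exp (-lv) ≤ 1 * Real.exp (-lv) := by gcongr
    linarith
  refine e1.trans (Real.exp_le_exp.2 ?_)
  have hn1 : 0 ≤ δ * n1 := by positivity
  have hn2 : 0 ≤ δ * n2 := by positivity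
  have e2 : lu ≤ Real.log 2 + (lv + γ) := by
    rw [← Real.exp_le_exp, Real.exp_add, Real.exp_log (by norm_num)]
    have h3 : 1 ≤ Real.exp (lv + γ) := Real.one_le_exp (by linarith)
    have h4 : Real.exp lv ≤ Real.exp (lv + γ) := Real.exp_le_exp.2 (by linarith)
    linarith
  have hl2 : 0 ≤ Real.log 2 := Real.log_nonneg (by norm_num)
  linarith

theorem quaternion_unit_equation_reduction (S₁ S₂ : Finset ℍ[ℝ])
    (hS₁ : ∀ g ∈ S₁, AlgQuat g ∧ 1 < ‖g‖) (hS₂ : ∀ g ∈ S₂, AlgQuat g ∧ 1 < ‖g‖)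
    (a a' b b' : ℍ[ℝ]) (ha : a ≠ 0) (ha' : a' ≠ 0) (hb : b ≠ 0) (hb' : b' ≠ 0)
    (haA : AlgQuat a) (haA' : AlgQuat a') (hbA : AlgQuat b) (hbA' : AlgQuat b') :
    {p : ℍ[ℝ] × ℍ[ℝ] | p.1 ∈ Subsemigroup.closure (S₁ : Set ℍ[ℝ]) ∧
      p.2 ∈ Subsemigroup.closure (S₂ : Set ℍ[ℝ]) ∧
      a * p.1 * a' + b * p.2 * b' = 1 ∧
      ‖1 - a * p.1 * a'‖ ≠ ‖a * p.1 * a'‖}.Finite := by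
  classical
  have hna := norm_ne_zero_iff.2 ha
  have hna' := norm_ne_zero_iff.2 ha'
  have hnb := norm_ne_zero_iff.2 hb
  have hnb' := norm_ne_zero_iff.2 hb'
  obtain ⟨δ₁, hδ₁, hm₁⟩ := aux_min S₁ (fun g hg => (hS₁ g hg).2)
  obtain ⟨δ₂, hδ₂, hm₂⟩ := aux_min S₂ (fun g hg => (hS₂ g hg).2)
  set δ := min δ₁ δ₂ with hδdef
  have hδ : 0 < δ := lt_min hδ₁ hδ₂
  set κ : ℝ := (‖a‖ * ‖a'‖) / (‖b‖ * ‖b'‖) with hκ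
  set α : S₁ ⊕ (S₂ ⊕ Unit) → ℝ := Sum.elim (fun x => ‖x.1‖) (Sum.elim (fun x => ‖x.1‖) (fun _ => κ)) with hα
  have hpos : ∀ i, 0 < α i := by
    rintro (x | x | x)
    · exact one_pos.trans (hS₁ x.1 x.2).2
    · exact one_pos.trans (hS₂ x.1 x.2).2
    · simp only [hα, Sum.elim_inr, hκ]; positivity
  have halg : ∀ i, IsAlgebraic ℚ (α i) := by
    rintro (x | x | x)
    · exact aux_alg_norm _ (hS₁ x.1 x.2).1
    · exact aux_alg_norm _ (hS₂ x.1 x.2).1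
    · simp only [hα, Sum.elim_inr, hκ, div_eq_mul_inv]
      exact ((aux_alg_norm _ haA).mul (aux_alg_norm _ haA')).mul
        (((aux_alg_norm _ hbA).mul (aux_alg_norm _ hbA')).inv)
  have hF := aux_main α hpos halg (δ/4) (by positivity)
  set F := {b : S₁ ⊕ (S₂ ⊕ Unit) → ℤ | (∑ i, b i * Real.log (α i)) ≠ 0 ∧
      |∑ i, b i * Real.log (α i)| ≤ Real.exp (-(δ/4) * (∑ i, (b i).natAbs : ℕ))} with hFdef
  obtain ⟨N1, hN1⟩ := (hF.image (fun b => ∑ i, (b i).natAbs)).bddAbove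
  set c1 := Real.log (‖a‖ * ‖a'‖) with hc1
  set c2 := Real.log (‖b‖ * ‖b'‖) with hc2
  set γ := |c1| + |c2| with hγ
  have hγ0 : 0 ≤ γ := by positivity
  obtain ⟨N0, hN0⟩ := exists_nat_ge ((Real.log 2 + 2 * γ + δ) * 4 / δ)
  rw [div_le_iff₀ hδ] at hN0
  set N := max N0 N1 with hN
  have hfin := ((List.finite_length_le S₁ N).prod (List.finite_length_le S₂ N)).image
    (fun l : List S₁ × List S₂ => ((l.1.map Subtype.val).prod, (l.2.map Subtype.val).prod))
  refine hfin.subset ?_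
  rintro ⟨f, g⟩ ⟨hf, hg, heq, hne⟩
  simp only at hf hg heq hne
  obtain ⟨l₁, rfl⟩ := aux_list S₁ f hf
  obtain ⟨l₂, rfl⟩ := aux_list S₂ g hg
  suffices hlen : l₁.length + l₂.length ≤ N by
    refine ⟨(l₁, l₂), ⟨?_, ?_⟩, rfl⟩
    · show l₁.length ≤ N; omega
    · show l₂.length ≤ N; omega
  obtain ⟨hlog₁, hne₁⟩ := aux_log_norm S₁ (fun g hg => (hS₁ g hg).2) l₁
  obtain ⟨hlog₂, hne₂⟩ := aux_log_norm S₂ (fun g hg => (hS₂ g hg).2) l₂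
  set f := (l₁.map Subtype.val).prod with hfdef
  set g := (l₂.map Subtype.val).prod with hgdef
  have hnf := norm_ne_zero_iff.2 hne₁
  have hng := norm_ne_zero_iff.2 hne₂
  have hle₁ := aux_len_le S₁ δ (fun g hg => (min_le_left _ _).trans (hm₁ g hg)) l₁
  have hle₂ := aux_len_le S₂ δ (fun g hg => (min_le_right _ _).trans (hm₂ g hg)) l₂
  rw [← hlog₁] at hle₁
  rw [← hlog₂] at hle₂
  have hgeq : b * g * b' = 1 - a * f * a' := by rw [← heq]; abel
  set lu := Real.log ‖a * f * a'‖ with hlu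
  set lv := Real.log ‖b * g * b'‖ with hlv
  have hlu' : lu = c1 + Real.log ‖f‖ := by
    rw [hlu, hc1, norm_mul, norm_mul, ← Real.log_mul (by positivity) hnf]; congr 1; ring
  have hlv' : lv = c2 + Real.log ‖g‖ := by
    rw [hlv, hc2, norm_mul, norm_mul, ← Real.log_mul (by positivity) hng]; congr 1; ring
  have hu0 : 0 < ‖a * f * a'‖ := norm_pos_iff.2 (mul_ne_zero (mul_ne_zero ha hne₁) ha')
  have hv0 : 0 < ‖b * g * b'‖ := norm_pos_iff.2 (mul_ne_zero (mul_ne_zero hb hne₂) hb')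
  have hdiff : |Real.exp lu - Real.exp lv| ≤ 1 := by
    rw [hlu, hlv, Real.exp_log hu0, Real.exp_log hv0]
    have h1 := abs_norm_sub_norm_le (a * f * a') (-(b * g * b'))
    rw [norm_neg, sub_neg_eq_add, heq, norm_one] at h1
    exact h1
  have hneq : lu - lv ≠ 0 := by
    intro h0
    apply hne
    rw [← hgeq]
    exact (Real.log_injOn_pos (Set.mem_Ioi.2 hu0) (Set.mem_Ioi.2 hv0) (sub_eq_zero.1 h0)).symm
  have g1 : -γ ≤ c1 := by linarith [neg_abs_le c1, abs_nonneg c2]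
  have g2 : -γ ≤ c2 := by linarith [neg_abs_le c2, abs_nonneg c1]
  have hsm : |lu - lv| ≤ Real.exp (Real.log 2 + 2 * γ - δ / 2 * (l₁.length + l₂.length)) := by
    rw [abs_le']
    refine ⟨aux_half γ δ lu lv _ _ hγ0 hδ (by linarith) (by linarith) hdiff, ?_⟩
    have := aux_half γ δ lv lu l₂.length l₁.length hγ0 hδ (by linarith) (by linarith) (by rw [abs_sub_comm]; exact hdiff)
    rw [neg_sub, add_comm (l₁.length : ℝ)]
    exact this
  set v : S₁ ⊕ (S₂ ⊕ Unit) → ℤ := Sum.elim (fun x => (l₁.count x : ℤ)) (Sum.elim (fun x => -(l₂.count x : ℤ)) (fun _ => 1)) with hv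
  have hsum : ∑ i, v i * Real.log (α i) = lu - lv := by
    rw [Fintype.sum_sum_type, Fintype.sum_sum_type]
    simp only [hv, hα, Sum.elim_inl, Sum.elim_inr, Int.cast_natCast, Int.cast_neg, Int.cast_one, neg_mul,
      Finset.sum_neg_distrib]
    rw [aux_count l₁ (fun x => Real.log ‖x.1‖), aux_count l₂ (fun x => Real.log ‖x.1‖), ← hlog₁, ← hlog₂, hlu', hlv']
    simp only [Finset.univ_unique, Finset.sum_singleton, one_mul]
    rw [hκ, Real.log_div (by positivity) (by positivity)]
    ring
  have hH : ∑ i, (v i).natAbs = l₁.length + l₂.length + 1 := by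
    rw [Fintype.sum_sum_type, Fintype.sum_sum_type]
    simp only [hv, Sum.elim_inl, Sum.elim_inr, Int.natAbs_neg, Int.natAbs_natCast]
    rw [aux_count_len, aux_count_len]
    simp
    ring
  by_contra hcon
  push Not at hcon
  have hbig : N0 < l₁.length + l₂.length := lt_of_le_of_lt (le_max_left _ _) hcon
  have hvF : v ∈ F := by
    refine ⟨by rw [hsum]; exact hneq, ?_⟩
    rw [hsum, hH]
    refine hsm.trans (Real.exp_le_exp.2 ?_)
    have h1 : (N0 : ℝ) < l₁.length + l₂.length := by exact_mod_cast hbig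
    have h2 := mul_lt_mul_of_pos_right h1 hδ
    push_cast
    linarith
  have h1 := hN1 ⟨v, hvF, rfl⟩
  simp only [hH] at h1
  have h2 : N1 ≤ N := le_max_right _ _
  omega
end
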